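/- arXiv:1103.4367 — 8 statements merged into one kernel-verified Lean document; each statement's English description precedes it below -/
import Mathlib

section
/- Let L be a Lie algebra over a field k of characteristic 0 and let λ ∈ L* be a nonzero linear form vanishing on ⁅L,L⁆. Set K_λ = ker λ and let D_λ be the k-linear span of {λ(l)u − ⁅l,u⁆ : l ∈ L, u ∈ K_λ}. Then for any z ∈ L with λ(z) = 1 one has D_λ = ⁅K_λ, K_λ⁆ + {u − ⁅z,u⁆ : u ∈ K_λ} (the second summand being the image of the linear map u ↦ u − ⁅z,u⁆ on K_λ), and D_λ is a Lie ideal of L. -/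
/-! Structure of the subspace `D_λ` for a nonzero `λ ∈ L*` vanishing on `⁅L,L⁆`. -/

variable (k L : Type*) [Field k] [CharZero k] [LieRing L] [LieAlgebra k L]

/-- The subspace `D_λ ⊆ K_λ`, the span of `{λ(l)u − ⁅l,u⁆ : l ∈ L, u ∈ K_λ}`. -/
def Dlam (lam : Module.Dual k L) : Submodule k L :=
  Submodule.span k {w | ∃ l : L, ∃ u ∈ LinearMap.ker lam, w = lam l • u - ⁅l, u⁆}

/-- The derived subspace `⁅K_λ, K_λ⁆`: the span of brackets of elements of `K_λ = ker λ`. -/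
def KlamDerived (lam : Module.Dual k L) : Submodule k L :=
  Submodule.span k {w | ∃ u ∈ LinearMap.ker lam, ∃ v ∈ LinearMap.ker lam, w = ⁅u, v⁆}

variable {k L} in
theorem Dlam_le_ker (lam : Module.Dual k L) (hlam : ∀ x y : L, lam ⁅x, y⁆ = 0) :
    Dlam k L lam ≤ LinearMap.ker lam := by
  refine Submodule.span_le.2 ?_
  rintro _ ⟨l, u, hu, rfl⟩
  have hu' : lam u = 0 := hu
  simp [hu', hlam]

/-- If `λ ∈ L*` is nonzero and vanishes on `⁅L,L⁆`, then for any `z ∈ L` with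
`λ(z) = 1` one has `D_λ = ⁅K_λ,K_λ⁆ + {u − ⁅z,u⁆ : u ∈ K_λ}`, and `D_λ` is a Lie ideal of `L`. -/
theorem Dlam_eq_and_isIdeal (lam : Module.Dual k L) (hlam_ne : lam ≠ 0)
    (hlam : ∀ x y : L, lam ⁅x, y⁆ = 0) (z : L) (hz : lam z = 1) :
    Dlam k L lam =
      KlamDerived k L lam ⊔
        Submodule.span k {w | ∃ u ∈ LinearMap.ker lam, w = u - ⁅z, u⁆} ∧
    ∀ x : L, ∀ y ∈ Dlam k L lam, ⁅x, y⁆ ∈ Dlam k L lam := by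
  refine ⟨le_antisymm (Submodule.span_le.2 ?_) (sup_le (Submodule.span_le.2 ?_)
    (Submodule.span_le.2 ?_)), fun x y hy => ?_⟩
  · rintro _ ⟨l, u, hu, rfl⟩
    have hv : l - lam l • z ∈ LinearMap.ker lam := by simp [hz]
    have hdecomp : lam l • u - ⁅l, u⁆ =
        -⁅l - lam l • z, u⁆ + lam l • (u - ⁅z, u⁆) := by
      rw [sub_lie, smul_lie, smul_sub]
      abel
    rw [SetLike.mem_coe, hdecomp]
    exact Submodule.add_mem_sup
      (neg_mem (Submodule.subset_span ⟨_, hv, u, hu, rfl⟩))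
      (Submodule.smul_mem _ _ (Submodule.subset_span ⟨u, hu, rfl⟩))
  · rintro _ ⟨u, hu, v, hv, rfl⟩
    have hu' : lam u = 0 := hu
    rw [SetLike.mem_coe, ← neg_mem_iff]
    exact Submodule.subset_span ⟨u, v, hv, by simp [hu']⟩
  · rintro _ ⟨u, hu, rfl⟩
    exact Submodule.subset_span ⟨z, u, hu, by simp [hz]⟩
  · have hgen : lam x • y - ⁅x, y⁆ ∈ Dlam k L lam :=
      Submodule.subset_span ⟨x, y, Dlam_le_ker lam hlam hy, rfl⟩
    simpa using sub_mem (Submodule.smul_mem _ (lam x) hy) hgen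
end

section
/- Let k be a field of characteristic 0, L a Lie algebra over k, V a finite-dimensional L-module, and K an ideal of L acting trivially on V such that the quotient Lie algebra L/K is finite-dimensional and semisimple. Then the map sending a derivation ∂ : L → V to its restriction ∂|_K induces a k-linear isomorphism H¹(L,V) ≅ Hom_L(K/⁅K,K⁆, V), where K/⁅K,K⁆ carries the L-module structure induced by the adjoint action of L on the ideal K (an action on which K itself acts trivially), and Hom_L denotes the space of L-module homomorphisms. -/
/-! `H¹(L,V) ≅ Hom_L(K/⁅K,K⁆, V)` when `K ⊆ ker ρ` is an ideal with `L/K` semisimple. -/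

variable (k L V : Type*) [Field k] [CharZero k] [LieRing L] [LieAlgebra k L]
  [AddCommGroup V] [Module k V] [LieRingModule L V] [LieModule k L V]

/-- The inner derivations from `L` to `V`, as a submodule of all Lie derivations. -/
def innerLieDerivations : Submodule k (LieDerivation k L V) where
  carrier := {d | ∃ v : V, ∀ x : L, d x = ⁅x, v⁆}
  add_mem' := by
    rintro d e ⟨v, hv⟩ ⟨w, hw⟩
    exact ⟨v + w, fun x => by simp [hv x, hw x]⟩
  zero_mem' := ⟨0, fun x => by simp⟩
  smul_mem' := by
    rintro c d ⟨v, hv⟩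
    exact ⟨c • v, fun x => by simp [hv x]⟩

/-- The first Lie algebra cohomology `H¹(L,V) = Der(L,V)/IDer(L,V)`. -/
def lieH1 := LieDerivation k L V ⧸ innerLieDerivations k L V

noncomputable instance : AddCommGroup (lieH1 k L V) := Submodule.Quotient.addCommGroup _
noncomputable instance : Module k (lieH1 k L V) := Submodule.Quotient.module _

/-- For an ideal `K` of `L`, the space `Hom_L(K/⁅K,K⁆, V)` of `L`-module homomorphisms,
realized as the submodule of linear maps `K → V` that vanish on brackets of elements of `K`
and are `L`-equivariant (here `K` carries the `L`-action induced by the adjoint action). -/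
def homLKabV (K : LieIdeal k L) : Submodule k (↥K →ₗ[k] V) where
  carrier := {f | (∀ u v : ↥K, f ⁅u, v⁆ = 0) ∧ ∀ (x : L) (u : ↥K), f ⁅x, u⁆ = ⁅x, f u⁆}
  add_mem' := by
    rintro f g ⟨hf0, hf⟩ ⟨hg0, hg⟩
    exact ⟨fun u v => by rw [LinearMap.add_apply, hf0 u v, hg0 u v, add_zero],
      fun x u => by simp [hf x u, hg x u, lie_add]⟩
  zero_mem' := ⟨fun u v => rfl, fun x u => by simp⟩
  smul_mem' := by
    rintro c f ⟨hf0, hf⟩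
    exact ⟨fun u v => by rw [LinearMap.smul_apply, hf0 u v, smul_zero],
      fun x u => by simp [hf x u]⟩

namespace LieModule

section Irreducible

variable {F : Type*} {S : Type*} [Field F] [LieRing S] [LieAlgebra F S]

/-- To prove a property of all finite-dimensional Lie modules it is enough to prove it for the
zero module and for irreducible modules, and to show that it is stable under extensions. -/
theorem induction_on_irreducible.{w}
    {P : ∀ (M : Type w) [AddCommGroup M] [Module F M] [LieRingModule S M] [LieModule F S M], Prop}
    (subsingleton : ∀ (M : Type w) [AddCommGroup M] [Module F M] [LieRingModule S M]
      [LieModule F S M] [Subsingleton M], P M)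
    (irreducible : ∀ (M : Type w) [AddCommGroup M] [Module F M] [LieRingModule S M]
      [LieModule F S M] [FiniteDimensional F M] [IsIrreducible F S M], P M)
    (extension : ∀ (M : Type w) [AddCommGroup M] [Module F M] [LieRingModule S M]
      [LieModule F S M] (N : LieSubmodule F S M), P N → P (M ⧸ N) → P M)
    (M : Type w) [AddCommGroup M] [Module F M] [LieRingModule S M] [LieModule F S M]
    [FiniteDimensional F M] : P M := by
  induction hn : Module.finrank F M using Nat.strong_induction_on generalizing M with
  | _ n ih =>
  subst hn
  rcases subsingleton_or_nontrivial M with hM | hM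
  · exact subsingleton M
  by_cases hN : ∀ N : LieSubmodule F S M, N ≠ ⊥ → N = ⊤
  · have := IsIrreducible.mk hN
    exact irreducible M
  · push Not at hN
    obtain ⟨N, hbot, htop⟩ := hN
    have hlt : Module.finrank F N < Module.finrank F M :=
      Submodule.finrank_lt (s := N.toSubmodule) (by simpa [lt_top_iff_ne_top] using htop)
    have hpos : 0 < Module.finrank F N := by
      have : Nontrivial N := (LieSubmodule.nontrivial_iff_ne_bot F S M).mpr hbot
      exact Module.finrank_pos
    have hadd : Module.finrank F (M ⧸ N) + Module.finrank F N = Module.finrank F M :=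
      Submodule.finrank_quotient_add_finrank N.toSubmodule
    have : FiniteDimensional F (M ⧸ N) :=
      inferInstanceAs (FiniteDimensional F (M ⧸ N.toSubmodule))
    exact extension M N (ih _ hlt N rfl) (ih _ (by lia) (M ⧸ N) rfl)

end Irreducible

section Semisimple

variable {F : Type*} {S : Type*} [Field F] [LieRing S] [LieAlgebra F S]
  [LieAlgebra.IsSemisimple F S]

/-- A semisimple Lie algebra is perfect. -/
theorem _root_.LieAlgebra.IsSemisimple.derivedSeries_one_eq_top :
    LieAlgebra.derivedSeries F S 1 = ⊤ := by
  obtain ⟨J, hJ⟩ := exists_isCompl (LieAlgebra.derivedSeries F S 1)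
  have hab : IsLieAbelian J := by
    refine (LieSubmodule.lie_abelian_iff_lie_self_eq_bot J).mpr ?_
    rw [← le_bot_iff, ← hJ.inf_eq_bot]
    refine le_inf ?_ (LieSubmodule.lie_le_right J J)
    exact LieSubmodule.mono_lie le_top le_top
  have hbot : J = ⊥ :=
    (LieAlgebra.hasTrivialRadical_iff_no_abelian_ideals F S).mp inferInstance J hab
  simpa [hbot] using hJ.sup_eq_top

/-- A linear map vanishing on all brackets of a semisimple Lie algebra is zero. -/
theorem _root_.LieAlgebra.IsSemisimple.linearMap_eq_zero {W : Type*} [AddCommGroup W] [Module F W]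
    (f : S →ₗ[F] W) (h : ∀ x y : S, f ⁅x, y⁆ = 0) : f = 0 := by
  have htop : (LieAlgebra.derivedSeries F S 1).toSubmodule ≤ LinearMap.ker f := by
    change (⁅(⊤ : LieIdeal F S), (⊤ : LieIdeal F S)⁆ : LieSubmodule F S S).toSubmodule ≤ _
    rw [LieSubmodule.lieIdeal_oper_eq_linear_span', Submodule.span_le]
    rintro _ ⟨x, -, y, -, rfl⟩
    exact h x y
  rw [LieAlgebra.IsSemisimple.derivedSeries_one_eq_top] at htop
  ext x
  exact htop (LieSubmodule.mem_top x)

variable [CharZero F] {M : Type*} [AddCommGroup M] [Module F M] [LieRingModule S M]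
  [LieModule F S M]

/-- If the trace form of a module over a semisimple Lie algebra is nonzero, then there is
an invariant tensor `∑ i, x i ⊗ y i` on which the trace form does not vanish. -/
theorem exists_invariant_tensor.{w} [FiniteDimensional F S] (h : traceForm F S M ≠ 0) :
    ∃ (n : ℕ) (x y : Fin n → S),
      (∀ (z : S) {W : Type w} [AddCommGroup W] [Module F W] (B : S →ₗ[F] S →ₗ[F] W),
        ∑ i, (B ⁅z, x i⁆ (y i) + B (x i) ⁅z, y i⁆) = 0) ∧
      ∑ i, traceForm F S M (x i) (y i) ≠ 0 := by
  obtain ⟨J, hJ⟩ := exists_isCompl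
    (LieAlgebra.InvariantForm.orthogonal (traceForm F S M) (traceForm_lieInvariant F S M) ⊤)
  obtain ⟨β, hβ⟩ : ∃ β : LinearMap.BilinForm F J, ∀ u v : J, β u v = traceForm F S M u v :=
    ⟨(traceForm F S M).restrict J.toSubmodule, fun _ _ ↦ rfl⟩
  have hsymm : β.IsSymm := ⟨fun u v ↦ by simp only [hβ, traceForm_comm F S M u v]⟩
  have hnondeg : β.Nondegenerate := by
    refine (LinearMap.BilinForm.Nondegenerate.ofSeparatingLeft ?_)
    intro u hu
    have hmem : (u : S) ∈
        LieAlgebra.InvariantForm.orthogonal (traceForm F S M) (traceForm_lieInvariant F S M) ⊤ := by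
      rw [LieAlgebra.InvariantForm.mem_orthogonal]
      intro s _
      have hs : s ∈ LieAlgebra.InvariantForm.orthogonal (traceForm F S M)
          (traceForm_lieInvariant F S M) ⊤ ⊔ J := by simp [hJ.sup_eq_top]
      obtain ⟨a, ha, b, hb, rfl⟩ := (LieSubmodule.mem_sup _ _ _).mp hs
      rw [LieAlgebra.InvariantForm.mem_orthogonal] at ha
      have h1 := ha u (LieSubmodule.mem_top _)
      have h2 := hu ⟨b, hb⟩
      rw [hβ] at h2
      rw [traceForm_comm, map_add, h1, h2, add_zero]
    have : (u : S) ∈ (⊥ : LieIdeal F S) := hJ.inf_eq_bot ▸ ⟨hmem, u.2⟩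
    exact Subtype.ext ((LieSubmodule.mem_bot _).mp this)
  let b : Module.Basis _ F J := Module.finBasis F J
  let b' : Module.Basis _ F J := β.dualBasis hnondeg b
  have hb (u : J) : ∑ j, β u (b' j) • (b j : S) = u := by
    have hrepr (j) : b.repr u j = β u (b' j) := by
      rw [← LinearMap.BilinForm.dualBasis_repr_apply hnondeg,
        LinearMap.BilinForm.dualBasis_dualBasis hnondeg hsymm]
    simpa [hrepr] using congrArg Subtype.val (b.sum_repr u)
  have hb' (u : J) : ∑ j, β u (b j) • (b' j : S) = u := by
    simpa [b'] using congrArg Subtype.val (b'.sum_repr u)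
  refine ⟨Module.finrank F J, fun i ↦ b i, fun i ↦ b' i, ?_, ?_⟩
  · intro z W _ _ B
    have h1 (i) : B ⁅z, (b i : S)⁆ (b' i) = ∑ j, β ⁅z, b i⁆ (b' j) • B (b j) (b' i) := by
      have := hb ⁅z, b i⁆
      rw [LieSubmodule.coe_bracket] at this
      rw [← this]
      simp
    have h2 (i) : B (b i) ⁅z, (b' i : S)⁆ = ∑ j, β ⁅z, b' i⁆ (b j) • B (b i) (b' j) := by
      have := hb' ⁅z, b' i⁆
      rw [LieSubmodule.coe_bracket] at this
      rw [← this]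
      simp
    have h3 (i j) : β ⁅z, b' i⁆ (b j) = - β ⁅z, b j⁆ (b' i) := by
      simp only [hβ, LieSubmodule.coe_bracket]
      rw [traceForm_comm, traceForm_apply_lie_apply', neg_neg]
    simp only [Finset.sum_add_distrib, h1, h2, h3]
    rw [Finset.sum_comm]
    simp
  · have h1 (i) : traceForm F S M (b i) (b' i) = 1 := by
      rw [← hβ, LinearMap.BilinForm.apply_dualBasis_right hnondeg hsymm, if_pos rfl]
    simp only [h1, Finset.sum_const, Finset.card_univ, Fintype.card_fin, nsmul_eq_mul, mul_one,
      ne_eq, Nat.cast_eq_zero]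
    intro h0
    have hJ0 : J = ⊥ := by
      have : J.toSubmodule = ⊥ := Submodule.finrank_eq_zero.mp h0
      simpa using this
    have htop : LieAlgebra.InvariantForm.orthogonal (traceForm F S M) (traceForm_lieInvariant F S M) ⊤ = ⊤ :=
      by simpa [hJ0] using hJ.sup_eq_top
    apply h
    ext s t
    exact (LieAlgebra.InvariantForm.mem_orthogonal _ _ _ t).mp (htop ▸ LieSubmodule.mem_top t) s
      (LieSubmodule.mem_top s)

variable [FiniteDimensional F M]

/-- An irreducible module over a semisimple Lie algebra with vanishing trace form is trivial. -/
theorem isTrivial_of_traceForm_eq_zero [IsIrreducible F S M] (h : traceForm F S M = 0) :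
    IsTrivial S M := by
  have hnil := isNilpotent_derivedSeries_of_traceForm_eq_zero h
  rw [isNilpotent_iff_forall' (R := F)] at hnil
  have hnil' : IsNilpotent S M := (isNilpotent_iff_forall' (R := F)).mpr fun x ↦
    hnil ⟨x, LieAlgebra.IsSemisimple.derivedSeries_one_eq_top (F := F) (S := S) ▸
      LieSubmodule.mem_top x⟩
  have := nontrivial_of_isIrreducible F S M
  have := nontrivial_max_triv_of_isNilpotent F S M
  have htop := LieSubmodule.eq_top_of_isIrreducible F S M (maxTrivSubmodule F S M)
  exact (isTrivial_iff_max_triv_eq_top F S M).mpr htop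

variable [FiniteDimensional F S]

/-- An irreducible module with nonzero trace form over a semisimple Lie algebra has an invertible
Casimir operator `m ↦ ∑ i, ⁅x i, ⁅y i, m⁆⁆`, built from an invariant tensor `∑ i, x i ⊗ y i`. -/
theorem exists_casimir_equiv [IsIrreducible F S M] (h : traceForm F S M ≠ 0) :
    ∃ (n : ℕ) (x y : Fin n → S) (Ω : M ≃ₗ[F] M),
      (∀ (z : S) (B : S →ₗ[F] S →ₗ[F] M),
        ∑ i, (B ⁅z, x i⁆ (y i) + B (x i) ⁅z, y i⁆) = 0) ∧
      (∀ m, Ω m = ∑ i, ⁅x i, ⁅y i, m⁆⁆) ∧ ∀ (z : S) (m : M), Ω ⁅z, m⁆ = ⁅z, Ω m⁆ := by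
  obtain ⟨n, x, y, hinv, htr⟩ := exists_invariant_tensor h
  let T : M →ₗ[F] M := ∑ i, toEnd F S M (x i) ∘ₗ toEnd F S M (y i)
  have hT (m : M) : T m = ∑ i, ⁅x i, ⁅y i, m⁆⁆ := by simp [T]
  have hcomm (z : S) (m : M) : T ⁅z, m⁆ = ⁅z, T m⁆ := by
    have := hinv z (LinearMap.mk₂ F (fun s t ↦ ⁅s, ⁅t, m⁆⁆) (by simp) (by simp) (by simp)
      (by simp))
    rw [hT, hT, lie_sum, eq_comm, ← sub_eq_zero, ← Finset.sum_sub_distrib, ← this]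
    refine Finset.sum_congr rfl fun i _ ↦ ?_
    simp only [LinearMap.mk₂_apply, lie_lie, lie_sub]
    abel
  let φ : M →ₗ⁅F, S⁆ M := { T with map_lie' := hcomm _ _ }
  have htrT : LinearMap.trace F M T ≠ 0 := by
    simpa [T, traceForm_apply_apply] using htr
  have hker : φ.ker = ⊥ := by
    refine (IsSimpleOrder.eq_bot_or_eq_top φ.ker).resolve_right fun htop ↦ htrT ?_
    have : T = 0 := by
      ext m
      exact φ.mem_ker.mp (htop ▸ LieSubmodule.mem_top m)
    rw [this, map_zero]
  have hinj : Function.Injective T := by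
    rw [← LinearMap.ker_eq_bot, LinearMap.ker_eq_bot']
    intro m hm
    have : m ∈ φ.ker := φ.mem_ker.mpr hm
    rwa [hker, LieSubmodule.mem_bot] at this
  exact ⟨n, x, y, LinearEquiv.ofInjectiveEndo T hinj, fun z B ↦ hinv z B, hT, hcomm⟩

variable (M) in
/-- **Whitehead's first lemma**: every derivation from a semisimple Lie algebra to
a finite-dimensional module is inner. -/
theorem exists_eq_lie_of_map_lie_eq_sub (c : S →ₗ[F] M)
    (hc : ∀ a b : S, c ⁅a, b⁆ = ⁅a, c b⁆ - ⁅b, c a⁆) : ∃ m : M, ∀ a : S, c a = ⁅a, m⁆ := by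
  refine induction_on_irreducible (F := F) (S := S) (P := fun M _ _ _ _ ↦ ∀ c : S →ₗ[F] M,
    (∀ a b : S, c ⁅a, b⁆ = ⁅a, c b⁆ - ⁅b, c a⁆) → ∃ m : M, ∀ a : S, c a = ⁅a, m⁆)
    ?_ ?_ ?_ M c hc
  · intro M _ _ _ _ _ c hc
    exact ⟨0, fun _ ↦ Subsingleton.elim _ _⟩
  · intro M _ _ _ _ _ _ c hc
    by_cases h : traceForm F S M = 0
    · have := isTrivial_of_traceForm_eq_zero h
      have : c = 0 := LieAlgebra.IsSemisimple.linearMap_eq_zero c fun a b ↦ by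
        simp only [hc, trivial_lie_zero, sub_self]
      exact ⟨0, fun a ↦ by simp [this]⟩
    obtain ⟨n, x, y, Ω, hinv, hΩ, hcomm⟩ := exists_casimir_equiv h
    refine ⟨Ω.symm (∑ i, ⁅x i, c (y i)⁆), fun a ↦ Ω.injective ?_⟩
    have := hinv a (LinearMap.mk₂ F (fun s t ↦ ⁅s, c t⁆) (by simp) (by simp) (by simp) (by simp))
    rw [hcomm, Ω.apply_symm_apply, hΩ, lie_sum, eq_comm, ← sub_eq_zero, ← Finset.sum_sub_distrib,
      ← this]
    refine Finset.sum_congr rfl fun i _ ↦ ?_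
    simp only [LinearMap.mk₂_apply, lie_lie, lie_sub, hc]
    abel
  · intro M _ _ _ _ N hN hQ c hc
    obtain ⟨q, hq⟩ := hQ ((LieSubmodule.Quotient.mk' N : M →ₗ[F] M ⧸ N) ∘ₗ c) fun a b ↦ by
      change LieSubmodule.Quotient.mk' N (c ⁅a, b⁆) =
        ⁅a, LieSubmodule.Quotient.mk' N (c b)⁆ - ⁅b, LieSubmodule.Quotient.mk' N (c a)⁆
      rw [hc, map_sub, LieModuleHom.map_lie, LieModuleHom.map_lie]
    obtain ⟨m, rfl⟩ := LieSubmodule.Quotient.surjective_mk' N q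
    have hmem (a : S) : c a - ⁅a, m⁆ ∈ N := by
      rw [← LieSubmodule.Quotient.mk_eq_zero, map_sub, sub_eq_zero, LieModuleHom.map_lie]
      exact hq a
    obtain ⟨p, hp⟩ := hN
      ((c - (toEnd F S M : S →ₗ[F] Module.End F M).flip m).codRestrict N.toSubmodule hmem)
      fun a b ↦ Subtype.ext <| by
        change c ⁅a, b⁆ - ⁅⁅a, b⁆, m⁆ = ⁅a, c b - ⁅b, m⁆⁆ - ⁅b, c a - ⁅a, m⁆⁆
        rw [hc, lie_lie, lie_sub, lie_sub]
        abel
    refine ⟨m + p, fun a ↦ ?_⟩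
    have : c a - ⁅a, m⁆ = ⁅a, (p : M)⁆ := congrArg Subtype.val (hp a)
    rw [lie_add, ← this, add_sub_cancel]

variable (M) in
/-- **Whitehead's second lemma**: every alternating `2`-cocycle of a semisimple Lie algebra with
values in a finite-dimensional module is a coboundary. -/
theorem exists_eq_coboundary_of_cocycle (c : S →ₗ[F] S →ₗ[F] M) (halt : ∀ a, c a a = 0)
    (hc : ∀ a b d : S, ⁅a, c b d⁆ - ⁅b, c a d⁆ + ⁅d, c a b⁆ - c ⁅a, b⁆ d + c ⁅a, d⁆ b
      - c ⁅b, d⁆ a = 0) :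
    ∃ g : S →ₗ[F] M, ∀ a b : S, c a b = ⁅a, g b⁆ - ⁅b, g a⁆ - g ⁅a, b⁆ := by
  refine induction_on_irreducible (F := F) (S := S) (P := fun M _ _ _ _ ↦
    ∀ c : S →ₗ[F] S →ₗ[F] M, (∀ a, c a a = 0) → (∀ a b d : S, ⁅a, c b d⁆ - ⁅b, c a d⁆ +
      ⁅d, c a b⁆ - c ⁅a, b⁆ d + c ⁅a, d⁆ b - c ⁅b, d⁆ a = 0) →
    ∃ g : S →ₗ[F] M, ∀ a b : S, c a b = ⁅a, g b⁆ - ⁅b, g a⁆ - g ⁅a, b⁆) ?_ ?_ ?_ M c halt hc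
  · intro M _ _ _ _ _ c halt hc
    exact ⟨0, fun _ _ ↦ Subsingleton.elim _ _⟩
  · intro M _ _ _ _ _ _ c halt hc
    have hskew (a b : S) : c a b = - c b a := by
      have := halt (a + b)
      simp only [map_add, LinearMap.add_apply, halt, zero_add, add_zero] at this
      exact eq_neg_of_add_eq_zero_right this
    by_cases h : traceForm F S M = 0
    · have := isTrivial_of_traceForm_eq_zero h
      obtain ⟨g, hg⟩ := exists_eq_lie_of_map_lie_eq_sub (S →ₗ[F] M) c fun a b ↦ by
        ext d
        have := hc a b d
        simp only [trivial_lie_zero] at this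
        simp only [LinearMap.sub_apply, LieHom.lie_apply, trivial_lie_zero, zero_sub]
        rw [hskew b ⁅a, d⁆, hskew a ⁅b, d⁆]
        grind
      refine ⟨g, fun a b ↦ ?_⟩
      simp only [hg, LieHom.lie_apply, trivial_lie_zero, sub_self]
    obtain ⟨n, x, y, Ω, hinv, hΩ, hcomm⟩ := exists_casimir_equiv h
    let w : S →ₗ[F] M := ∑ i, toEnd F S M (x i) ∘ₗ c (y i)
    have hw (a : S) : w a = ∑ i, ⁅x i, c (y i) a⁆ := by simp [w]
    refine ⟨Ω.symm ∘ₗ w, fun a b ↦ Ω.injective ?_⟩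
    simp only [map_sub, hcomm, LinearMap.comp_apply, LinearEquiv.coe_coe, Ω.apply_symm_apply]
    have h1 := hinv a (LinearMap.mk₂ F (fun s t ↦ ⁅s, c t b⁆) (by simp) (by simp) (by simp)
      (by simp))
    have h2 := hinv b (LinearMap.mk₂ F (fun s t ↦ ⁅s, c t a⁆) (by simp) (by simp) (by simp)
      (by simp))
    have h3 := congrArg₂ (· - ·) h2 h1
    simp only [sub_self, ← Finset.sum_sub_distrib] at h3
    rw [← sub_eq_zero]
    refine Eq.trans ?_ h3
    simp only [hΩ, hw, lie_sum, ← Finset.sum_sub_distrib]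
    refine Finset.sum_congr rfl fun i _ ↦ ?_
    have := hc (y i) a b
    rw [hskew ⁅a, b⁆ (y i), ← lie_skew (y i) a, ← lie_skew (y i) b] at this
    simp only [map_neg, LinearMap.neg_apply] at this
    have := congrArg (⁅x i, ·⁆) this
    simp only [lie_sub, lie_add, lie_neg, lie_zero] at this
    simp only [LinearMap.mk₂_apply, lie_lie]
    grind
  · intro M _ _ _ _ N hN hQ c halt hc
    obtain ⟨q, hq⟩ := hQ (c.compr₂ (LieSubmodule.Quotient.mk' N : M →ₗ[F] M ⧸ N))
      (fun a ↦ by simp [halt]) fun a b d ↦ by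
        have := congrArg (LieSubmodule.Quotient.mk' N) (hc a b d)
        simp only [map_add, map_sub, LieModuleHom.map_lie, map_zero] at this
        exact this
    obtain ⟨g, rfl⟩ := Module.projective_lifting_property
      (LieSubmodule.Quotient.mk' N : M →ₗ[F] M ⧸ N) q (LieSubmodule.Quotient.surjective_mk' N)
    let dg := Cohomology.d₁₂ F S M g
    have hmem (a b : S) : c a b - dg a b ∈ N := by
      rw [← LieSubmodule.Quotient.mk_eq_zero, map_sub, sub_eq_zero, Cohomology.d₁₂_apply_apply,
        map_sub, map_sub, LieModuleHom.map_lie, LieModuleHom.map_lie]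
      exact hq a b
    obtain ⟨g', hg'⟩ := hN
      (LinearMap.mk₂ F (fun a b ↦ (⟨c a b - dg a b, hmem a b⟩ : N))
        (fun a b d ↦ Subtype.ext <| by simp; abel)
        (fun r a b ↦ Subtype.ext <| by simp [smul_sub])
        (fun a b d ↦ Subtype.ext <| by simp; abel)
        (fun r a b ↦ Subtype.ext <| by simp [smul_sub]))
      (fun a ↦ Subtype.ext <| by simp [halt])
      fun a b d ↦ Subtype.ext <| by
        have h1 := hc a b d
        have h2 : Cohomology.d₂₃ F S M dg a b d = 0 := by
          rw [← LinearMap.comp_apply, Cohomology.d₂₃_comp_d₁₂]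
          rfl
        rw [Cohomology.d₂₃_apply] at h2
        simp only [LinearMap.mk₂_apply, LieSubmodule.coe_add, LieSubmodule.coe_sub,
          LieSubmodule.coe_bracket, LieSubmodule.coe_zero, lie_sub]
        grind
    refine ⟨g + N.toSubmodule.subtype ∘ₗ g', fun a b ↦ ?_⟩
    have : c a b - dg a b = ⁅a, (g' b : M)⁆ - ⁅b, (g' a : M)⁆ - g' ⁅a, b⁆ :=
      congrArg Subtype.val (hg' a b)
    rw [sub_eq_iff_eq_add, Cohomology.d₁₂_apply_apply] at this
    rw [this]
    simp only [LinearMap.add_apply, LinearMap.comp_apply, Submodule.subtype_apply, lie_add]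
    abel

end Semisimple

section Restriction

variable {F : Type*} {G : Type*} {W : Type*} [Field F] [LieRing G] [LieAlgebra F G]
  [AddCommGroup W] [Module F W] [LieRingModule G W] [LieModule F G W]

/-- If an ideal `K` acts trivially on a module, then the action descends to the quotient by `K`. -/
theorem exists_quotient_lieModule (K : LieIdeal F G) (hK : ∀ (x : K) (w : W), ⁅(x : G), w⁆ = 0) :
    ∃ (_ : LieRingModule (G ⧸ K) W) (_ : LieModule F (G ⧸ K) W),
      ∀ (x : G) (w : W), ⁅LieSubmodule.Quotient.mk' K x, w⁆ = ⁅x, w⁆ := by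
  let : LieRing (Module.End F W) := LieRing.ofAssociativeRing
  let ρ : (G ⧸ K) →ₗ⁅F⁆ Module.End F W :=
    { K.toSubmodule.liftQ (LieModule.toEnd F G W : G →ₗ[F] Module.End F W)
        fun x hx ↦ LinearMap.ext fun w ↦ hK ⟨x, hx⟩ w with
      map_lie' := fun {s t} ↦ by
        obtain ⟨a, rfl⟩ := LieSubmodule.Quotient.surjective_mk' K s
        obtain ⟨b, rfl⟩ := LieSubmodule.Quotient.surjective_mk' K t
        exact LieHom.map_lie (LieModule.toEnd F G W) a b }
  let : LieRingModule (G ⧸ K) W := LieRingModule.compLieHom W ρ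
  exact ⟨inferInstance, LieModule.compLieHom W ρ, fun _ _ ↦ rfl⟩

/-- Restriction of derivations to an ideal acting trivially on the module. -/
def restrictDerivation (K : LieIdeal F G) (hK : ∀ (x : K) (w : W), ⁅(x : G), w⁆ = 0) :
    LieDerivation F G W →ₗ[F] homLKabV F G W K where
  toFun d := ⟨(d : G →ₗ[F] W) ∘ₗ K.toSubmodule.subtype,
    fun u v ↦ (d.apply_lie_eq_sub u v).trans (by rw [hK, hK, sub_zero]),
    fun x u ↦ (d.apply_lie_eq_sub x u).trans (by rw [hK, sub_zero]; rfl)⟩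
  map_add' _ _ := rfl
  map_smul' _ _ := rfl

theorem restrictDerivation_apply (K : LieIdeal F G) (hK : ∀ (x : K) (w : W), ⁅(x : G), w⁆ = 0)
    (d : LieDerivation F G W) (u : K) :
    (restrictDerivation K hK d : K →ₗ[F] W) u = d u := rfl

variable [CharZero F] [FiniteDimensional F W]
  (K : LieIdeal F G) (hK : ∀ (x : K) (w : W), ⁅(x : G), w⁆ = 0)
  [FiniteDimensional F (G ⧸ K)] [LieAlgebra.IsSemisimple F (G ⧸ K)]

theorem ker_restrictDerivation :
    (restrictDerivation K hK).ker = innerLieDerivations F G W := by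
  ext d
  rw [LinearMap.mem_ker]
  constructor
  · intro hd
    have hd' (u : K) : d u = 0 := by rw [← restrictDerivation_apply K hK, hd]; rfl
    obtain ⟨_, _, hmk⟩ := exists_quotient_lieModule K hK
    let δ : (G ⧸ K) →ₗ[F] W := K.toSubmodule.liftQ (d : G →ₗ[F] W) fun x hx ↦ hd' ⟨x, hx⟩
    obtain ⟨m, hm⟩ := exists_eq_lie_of_map_lie_eq_sub W δ fun s t ↦ by
      obtain ⟨a, rfl⟩ := LieSubmodule.Quotient.surjective_mk' K s
      obtain ⟨b, rfl⟩ := LieSubmodule.Quotient.surjective_mk' K t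
      rw [hmk, hmk]
      exact d.apply_lie_eq_sub a b
    exact ⟨m, fun x ↦ (hm (LieSubmodule.Quotient.mk' K x)).trans (hmk x m)⟩
  · rintro ⟨v, hv⟩
    exact Subtype.ext <| LinearMap.ext fun u ↦ (hv u).trans (hK u v)

theorem restrictDerivation_surjective : Function.Surjective (restrictDerivation K hK) := by
  intro f
  obtain ⟨_, _, hmk⟩ := exists_quotient_lieModule K hK
  let π : G →ₗ[F] G ⧸ K := K.toSubmodule.mkQ
  have hπ (x y : G) : π ⁅x, y⁆ = ⁅π x, π y⁆ := rfl
  have hmk (x : G) (w : W) : ⁅π x, w⁆ = ⁅x, w⁆ := hmk x w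
  obtain ⟨σ, hσ⟩ := π.exists_rightInverse_of_surjective K.toSubmodule.range_mkQ
  have hσ (s : G ⧸ K) : π (σ s) = s := LinearMap.congr_fun hσ s
  have hπ0 {x : G} : π x = 0 ↔ x ∈ K := K.toSubmodule.mkQ_apply x ▸ Submodule.Quotient.mk_eq_zero _
  obtain ⟨φ, hφ⟩ := (f : K →ₗ[F] W).exists_extend (p := K.toSubmodule)
  have hφ (u : K) : φ u = f.1 u := LinearMap.congr_fun hφ u
  let dφ := Cohomology.d₁₂ F G W φ
  have hdφ (x y : G) : dφ x y = ⁅x, φ y⁆ - ⁅y, φ x⁆ - φ ⁅x, y⁆ :=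
    Cohomology.d₁₂_apply_apply ..
  have hdK (x : G) {u : G} (hu : u ∈ K) : dφ x u = 0 := by
    have := (hφ ⁅x, (⟨u, hu⟩ : K)⁆).trans (f.2.2 x ⟨u, hu⟩)
    rw [← hφ] at this
    rw [hdφ, hK ⟨u, hu⟩, sub_zero, sub_eq_zero]
    exact this.symm
  have halt (x : G) : dφ x x = 0 := by simp [hdφ]
  have hskew (x y : G) : dφ x y = - dφ y x := by
    rw [hdφ, hdφ, ← lie_skew x y, map_neg]
    abel
  have hσK (x : G) : σ (π x) - x ∈ K := by rw [← hπ0, map_sub, hσ, sub_self]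
  have hr (x y : G) : dφ x (σ (π y)) = dφ x y := by
    rw [← sub_eq_zero, ← map_sub, hdK x (hσK y)]
  have hl (x y : G) : dφ (σ (π x)) y = dφ x y := by rw [hskew, hr, ← hskew]
  obtain ⟨g, hg⟩ := exists_eq_coboundary_of_cocycle W ((dφ : G →ₗ[F] G →ₗ[F] W).compl₁₂ σ σ)
    (fun s ↦ halt (σ s)) fun s t r ↦ by
      obtain ⟨a, rfl⟩ := K.toSubmodule.mkQ_surjective s
      obtain ⟨b, rfl⟩ := K.toSubmodule.mkQ_surjective t
      obtain ⟨d, rfl⟩ := K.toSubmodule.mkQ_surjective r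
      have h : Cohomology.d₂₃ F G W dφ a b d = 0 := by
        rw [← LinearMap.comp_apply, Cohomology.d₂₃_comp_d₁₂]
        rfl
      rw [Cohomology.d₂₃_apply] at h
      change ⁅π a, dφ (σ (π b)) (σ (π d))⁆ - ⁅π b, dφ (σ (π a)) (σ (π d))⁆
        + ⁅π d, dφ (σ (π a)) (σ (π b))⁆ - dφ (σ (π ⁅a, b⁆)) (σ (π d))
        + dφ (σ (π ⁅a, d⁆)) (σ (π b)) - dφ (σ (π ⁅b, d⁆)) (σ (π a)) = 0
      simp only [hl, hr, hmk]
      exact h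
  have hg (x y : G) : dφ x y = ⁅x, g (π y)⁆ - ⁅y, g (π x)⁆ - g (π ⁅x, y⁆) := by
    rw [← hmk, ← hmk, ← hl, ← hr]
    exact hg (π x) (π y)
  refine ⟨⟨φ - g ∘ₗ π, fun x y ↦ ?_⟩, Subtype.ext <| LinearMap.ext fun u ↦ ?_⟩
  · have := hg x y
    rw [hdφ] at this
    simp only [LinearMap.sub_apply, LinearMap.comp_apply, lie_sub]
    grind
  · change φ u - g (π u) = f.1 u
    rw [hπ0.mpr u.2, map_zero, sub_zero, hφ]

end Restriction

end LieModule

/-- Let `V` be a finite-dimensional `L`-module and `K` an ideal of `L` acting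
trivially on `V`, with `L/K` finite-dimensional and semisimple.  Then restriction of derivations
to `K` induces a `k`-linear isomorphism `H¹(L,V) ≅ Hom_L(K/⁅K,K⁆, V)`. -/
theorem lieH1_iso_homLKabV [FiniteDimensional k V] (K : LieIdeal k L)
    (hKtriv : ∀ x : ↥K, ∀ v : V, ⁅(x : L), v⁆ = 0)
    [FiniteDimensional k (L ⧸ K)] [LieAlgebra.IsSemisimple k (L ⧸ K)] :
    ∃ e : lieH1 k L V ≃ₗ[k] ↥(homLKabV k L V K),
      ∀ (d : LieDerivation k L V) (u : ↥K),
        ((e (Submodule.Quotient.mk d) : ↥K →ₗ[k] V)) u = d (u : L) := by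
  let r := LieModule.restrictDerivation K hKtriv
  let e : lieH1 k L V ≃ₗ[k] ↥(homLKabV k L V K) :=
    (Submodule.quotEquivOfEq _ _ (LieModule.ker_restrictDerivation K hKtriv).symm).trans
      (r.quotKerEquivOfSurjective (LieModule.restrictDerivation_surjective K hKtriv))
  exact ⟨e, fun _ _ ↦ rfl⟩
end

section
/- Let k be a field of characteristic 0, L a Lie algebra over k, ρ : L → End_k(V) a finite-dimensional representation, and K ⊆ ker ρ an ideal of L such that the quotient Lie algebra l = L/K is finite-dimensional and reductive (l is the direct sum of its center and its derived subalgebra, the latter being semisimple). Assume V is completely reducible as an L-module (a direct sum of irreducible submodules) and that there exists z ∈ L whose image in l lies in the center of l and for which ρ(z) is invertible. Then the map sending a derivation ∂ : L → V to its restriction ∂|_K induces a k-linear isomorphism H¹(L,V) ≅ Hom_L(K/⁅K,K⁆, V), where K/⁅K,K⁆ carries the L-module structure induced by the adjoint action and Hom_L denotes the space of L-module homomorphisms. -/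
/-! `H¹(L,V) ≅ Hom_L(K/⁅K,K⁆, V)` when `K ⊆ ker ρ` is an ideal with `L/K` reductive,
`V` completely reducible and some central element acting invertibly. -/

universe u₁ u₂ u₃

variable (k : Type u₁) (L : Type u₂) (V : Type u₃) [Field k] [CharZero k]
  [LieRing L] [LieAlgebra k L]
  [AddCommGroup V] [Module k V] [LieRingModule L V] [LieModule k L V]

section Restriction

variable {k L V : Type*} [Field k] [LieRing L] [LieAlgebra k L] {K : LieIdeal k L}
  [AddCommGroup V] [LieRingModule L V]

/-- An element that is central modulo `K` brackets all of `L` into `K`. -/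
theorem LieIdeal.lie_mem_of_mk_mem_center {z : L}
    (hz : LieSubmodule.Quotient.mk' K z ∈ LieAlgebra.center k (L ⧸ K)) (x : L) :
    ⁅z, x⁆ ∈ K := by
  rw [← lie_skew, neg_mem_iff, ← LieSubmodule.Quotient.mk_eq_zero]
  exact (LieModule.mem_maxTrivSubmodule _ _ _ _).1 hz (LieSubmodule.Quotient.mk' K x)

/-- If `z` is central modulo an ideal acting trivially on `V`, it acts on `V` by an
`L`-endomorphism. -/
theorem lie_lie_comm_of_mk_mem_center (hK : ∀ x : ↥K, ∀ v : V, ⁅(x : L), v⁆ = 0) {z : L}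
    (hz : LieSubmodule.Quotient.mk' K z ∈ LieAlgebra.center k (L ⧸ K)) (x : L) (v : V) :
    ⁅z, ⁅x, v⁆⁆ = ⁅x, ⁅z, v⁆⁆ := by
  rw [leibniz_lie, hK ⟨⁅z, x⁆, LieIdeal.lie_mem_of_mk_mem_center hz x⟩, zero_add]

variable [Module k V] [LieModule k L V]

/-- If `K` acts trivially on `V`, restricting a derivation `L → V` to `K` gives an `L`-module
homomorphism that vanishes on `⁅K, K⁆`. -/
def LieDerivation.restrictIdeal (hK : ∀ x : ↥K, ∀ v : V, ⁅(x : L), v⁆ = 0) :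
    LieDerivation k L V →ₗ[k] ↥(homLKabV k L V K) where
  toFun d := ⟨(d : L →ₗ[k] V) ∘ₗ (K : Submodule k L).subtype,
    fun u v => by
      change d ⁅(u : L), (v : L)⁆ = 0
      rw [d.apply_lie_eq_sub, hK, hK, sub_zero],
    fun x u => by
      change d ⁅x, (u : L)⁆ = ⁅x, d (u : L)⁆
      rw [d.apply_lie_eq_sub, hK, sub_zero]⟩
  map_add' _ _ := rfl
  map_smul' _ _ := rfl

theorem LieDerivation.restrictIdeal_apply (hK : ∀ x : ↥K, ∀ v : V, ⁅(x : L), v⁆ = 0)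
    (d : LieDerivation k L V) (u : ↥K) :
    (LieDerivation.restrictIdeal hK d : ↥K →ₗ[k] V) u = d (u : L) := rfl

theorem LieDerivation.ker_restrictIdeal (hK : ∀ x : ↥K, ∀ v : V, ⁅(x : L), v⁆ = 0) {z : L}
    (hz : LieSubmodule.Quotient.mk' K z ∈ LieAlgebra.center k (L ⧸ K))
    (hzinv : Function.Bijective fun v : V => ⁅z, v⁆) :
    LinearMap.ker (LieDerivation.restrictIdeal hK) = innerLieDerivations k L V := by
  ext d
  rw [LinearMap.mem_ker]
  constructor
  · intro hd
    have hd' (u : ↥K) : d (u : L) = 0 := by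
      rw [← LieDerivation.restrictIdeal_apply hK, hd]
      rfl
    obtain ⟨v, hv⟩ := hzinv.2 (d z)
    refine ⟨v, fun x => hzinv.1 ?_⟩
    have h := hd' ⟨⁅z, x⁆, LieIdeal.lie_mem_of_mk_mem_center hz x⟩
    rw [d.apply_lie_eq_sub, sub_eq_zero, ← hv] at h
    exact h.trans (lie_lie_comm_of_mk_mem_center hK hz x v).symm
  · rintro ⟨v, hv⟩
    ext u
    exact (hv u).trans (hK u v)

/-- The derivation extending `f : K → V` is `x ↦ z⁻¹ • f ⁅z, x⁆`. -/
theorem LieDerivation.restrictIdeal_surjective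
    (hK : ∀ x : ↥K, ∀ v : V, ⁅(x : L), v⁆ = 0) {z : L}
    (hz : LieSubmodule.Quotient.mk' K z ∈ LieAlgebra.center k (L ⧸ K))
    (hzinv : Function.Bijective fun v : V => ⁅z, v⁆) :
    Function.Surjective (LieDerivation.restrictIdeal (k := k) hK) := by
  rintro ⟨f, hf₀, hf⟩
  have hmem := LieIdeal.lie_mem_of_mk_mem_center hz
  let T : V ≃ₗ[k] V := LinearEquiv.ofBijective (LieModule.toEnd k L V z) hzinv
  let g : L →ₗ[k] V :=
    T.symm.toLinearMap ∘ₗ f ∘ₗ (LieAlgebra.ad k L z).codRestrict (K : Submodule k L) hmem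
  have hg (x : L) : ⁅z, g x⁆ = f ⟨⁅z, x⁆, hmem x⟩ := T.apply_symm_apply _
  refine ⟨⟨g, fun x y => hzinv.1 ?_⟩, ?_⟩
  · have key : (⟨⁅z, ⁅x, y⁆⁆, hmem _⟩ : ↥K) =
        ⁅x, (⟨⁅z, y⁆, hmem y⟩ : ↥K)⁆ - ⁅y, (⟨⁅z, x⁆, hmem x⟩ : ↥K)⁆ := by
      ext
      change ⁅z, ⁅x, y⁆⁆ = ⁅x, ⁅z, y⁆⁆ - ⁅y, ⁅z, x⁆⁆
      rw [leibniz_lie, ← lie_skew ⁅z, x⁆ y]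
      abel
    change ⁅z, g ⁅x, y⁆⁆ = ⁅z, ⁅x, g y⁆ - ⁅y, g x⁆⁆
    rw [hg, key, map_sub, hf, hf, lie_sub, lie_lie_comm_of_mk_mem_center hK hz,
      lie_lie_comm_of_mk_mem_center hK hz, hg, hg]
  · ext u
    refine hzinv.1 ?_
    change ⁅z, g u⁆ = ⁅z, f u⁆
    rw [hg, ← hf]
    rfl

end Restriction

/-- Let `ρ : L → End(V)` be a finite-dimensional representation and
`K ⊆ ker ρ` an ideal with `l = L/K` finite-dimensional reductive (the direct sum of its center
and its derived subalgebra, the latter semisimple).  If `V` is completely reducible and there is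
`z ∈ L` whose image in `l` is central and which acts invertibly on `V`, then restriction of
derivations to `K` induces a `k`-linear isomorphism `H¹(L,V) ≅ Hom_L(K/⁅K,K⁆, V)`. -/
theorem lieH1_iso_homLKabV_reductive [FiniteDimensional k V] (K : LieIdeal k L)
    (hKtriv : ∀ x : ↥K, ∀ v : V, ⁅(x : L), v⁆ = 0)
    [FiniteDimensional k (L ⧸ K)]
    -- `L/K` is reductive:
    (hred₁ : (LieAlgebra.center k (L ⧸ K)) ⊓ (LieAlgebra.derivedSeries k (L ⧸ K) 1) = ⊥)
    (hred₂ : (LieAlgebra.center k (L ⧸ K)) ⊔ (LieAlgebra.derivedSeries k (L ⧸ K) 1) = ⊤)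
    (hred₃ : LieAlgebra.IsSemisimple k ↥(LieAlgebra.derivedSeries k (L ⧸ K) 1))
    -- `V` is completely reducible as an `L`-module (a direct sum of irreducible submodules):
    (hV : ∃ (ι : Type u₃) (_ : DecidableEq ι) (N : ι → LieSubmodule k L V),
      DirectSum.IsInternal (fun i => (N i : Submodule k V)) ∧
        ∀ i, LieModule.IsIrreducible k L ↥(N i))
    -- a central element of `l` acting invertibly on `V`:
    (z : L) (hz : LieSubmodule.Quotient.mk' K z ∈ LieAlgebra.center k (L ⧸ K))
    (hzinv : Function.Bijective fun v : V => ⁅z, v⁆) :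
    ∃ e : lieH1 k L V ≃ₗ[k] ↥(homLKabV k L V K),
      ∀ (d : LieDerivation k L V) (u : ↥K),
        ((e (Submodule.Quotient.mk d) : ↥K →ₗ[k] V)) u = d (u : L) := by
  exact ⟨(Submodule.quotEquivOfEq _ _
      (LieDerivation.ker_restrictIdeal hKtriv hz hzinv).symm).trans
    ((LieDerivation.restrictIdeal hKtriv).quotKerEquivOfSurjective
      (LieDerivation.restrictIdeal_surjective hKtriv hz hzinv)), fun _ _ => rfl⟩
end

section
/- Let Ξ be an abelian group and let A = ⊕_{ξ∈Ξ} A_ξ be a commutative unital ring graded by Ξ (so A_τ·A_ξ ⊆ A_{τ+ξ} for all τ,ξ ∈ Ξ and 1 ∈ A_0). For a homogeneous ideal I of A and ξ ∈ Ξ write I_ξ = I ∩ A_ξ. Then the following are equivalent: (i) A_ξ·A_{−ξ} = A_0 for all ξ ∈ Ξ; (ii) the grading is strong, i.e. A_τ·A_ξ = A_{τ+ξ} for all τ,ξ ∈ Ξ; (iii) for every homogeneous ideal I of A, every n ≥ 1 and all ξ₁,…,ξₙ ∈ Ξ, the product I_{ξ₁}·I_{ξ₂}···I_{ξₙ} equals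 (Iⁿ)_{ξ₁+⋯+ξₙ}, the (ξ₁+⋯+ξₙ)-component of the n-th power of the ideal I. -/
/-! Strong gradings of a commutative ring by an abelian group. -/

variable {Ξ A : Type*} [AddCommGroup Ξ] [DecidableEq Ξ] [CommRing A]
variable (𝒜 : Ξ → Submodule ℤ A)

/-- The ξ-component `I_ξ = I ∩ A_ξ` of an ideal `I`, as an additive subgroup
(`ℤ`-submodule) of `A`. -/
def idealComponent (I : Ideal A) (ξ : Ξ) : Submodule ℤ A :=
  (I.restrictScalars ℤ) ⊓ 𝒜 ξ

/-- An ideal `I` is homogeneous if `I = ⊕_ξ (I ∩ A_ξ)`, i.e. all homogeneous components of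
elements of `I` again lie in `I`. -/
def IsHomogIdeal [GradedRing 𝒜] (I : Ideal A) : Prop :=
  ∀ a ∈ I, ∀ ξ : Ξ, (DirectSum.decompose 𝒜 a ξ : A) ∈ I

section

variable {𝒜}

theorem idealComponent_mul_le [GradedRing 𝒜] (I J : Ideal A) (a b : Ξ) :
    idealComponent 𝒜 I a * idealComponent 𝒜 J b ≤ idealComponent 𝒜 (I * J) (a + b) :=
  Submodule.mul_le.2 fun _ hx _ hy =>
    ⟨Ideal.mul_mem_mul hx.1 hy.1, SetLike.mul_mem_graded hx.2 hy.2⟩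

theorem idealComponent_top {ι R : Type*} [CommRing R] (ℬ : ι → Submodule ℤ R) (i : ι) :
    idealComponent ℬ ⊤ i = ℬ i := by
  ext x
  simp [idealComponent]

theorem idealComponent_mul_grade_le [GradedRing 𝒜] (I : Ideal A) (a b : Ξ) :
    idealComponent 𝒜 I a * 𝒜 b ≤ idealComponent 𝒜 I (a + b) := by
  simpa only [idealComponent_top, Ideal.mul_top] using idealComponent_mul_le (𝒜 := 𝒜) I ⊤ a b

theorem one_le_grade_mul_grade_neg [GradedRing 𝒜] (h : ∀ ξ : Ξ, 𝒜 ξ * 𝒜 (-ξ) = 𝒜 0) (ξ : Ξ) :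
    1 ≤ 𝒜 ξ * 𝒜 (-ξ) := by
  rw [h, Submodule.one_le]
  exact SetLike.one_mem_graded 𝒜

theorem idealComponent_mul_le_of_add_eq [GradedRing 𝒜] (h : ∀ ξ : Ξ, 𝒜 ξ * 𝒜 (-ξ) = 𝒜 0)
    (I J : Ideal A) {a b d e : Ξ} (hab : d + e = a + b) :
    idealComponent 𝒜 I d * idealComponent 𝒜 J e ≤
      idealComponent 𝒜 I a * idealComponent 𝒜 J b :=
  calc idealComponent 𝒜 I d * idealComponent 𝒜 J e
      = 1 * (idealComponent 𝒜 I d * idealComponent 𝒜 J e) := (one_mul _).symm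
    _ ≤ (𝒜 (a - d) * 𝒜 (-(a - d))) * (idealComponent 𝒜 I d * idealComponent 𝒜 J e) :=
        mul_le_mul' (one_le_grade_mul_grade_neg h _) le_rfl
    _ = (idealComponent 𝒜 I d * 𝒜 (a - d)) * (idealComponent 𝒜 J e * 𝒜 (-(a - d))) := by ring
    _ ≤ idealComponent 𝒜 I (d + (a - d)) * idealComponent 𝒜 J (e + -(a - d)) :=
        mul_le_mul' (idealComponent_mul_grade_le I _ _) (idealComponent_mul_grade_le J _ _)
    _ = idealComponent 𝒜 I a * idealComponent 𝒜 J b := by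
        congr 2
        · abel
        · rw [show e + -(a - d) = (d + e) - a by abel, hab]
          abel

theorem decompose_mem_idealComponent_mul [GradedRing 𝒜] (h : ∀ ξ : Ξ, 𝒜 ξ * 𝒜 (-ξ) = 𝒜 0)
    {I J : Ideal A} (hI : IsHomogIdeal 𝒜 I) (hJ : IsHomogIdeal 𝒜 J) (a b : Ξ) {z : A}
    (hz : z ∈ I * J) :
    (DirectSum.decompose 𝒜 z (a + b) : A) ∈ idealComponent 𝒜 I a * idealComponent 𝒜 J b := by
  classical
  induction hz using Submodule.mul_induction_on' with
  | mem_mul_mem x hx y hy =>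
    rw [DirectSum.decompose_mul, DirectSum.coe_mul_apply]
    refine Submodule.sum_mem _ fun p hp => ?_
    exact idealComponent_mul_le_of_add_eq h I J (Finset.mem_filter.1 hp).2
      (Submodule.mul_mem_mul ⟨hI x hx _, SetLike.coe_mem _⟩ ⟨hJ y hy _, SetLike.coe_mem _⟩)
  | add x _ y _ hx hy =>
    rw [DirectSum.decompose_add, DirectSum.add_apply, Submodule.coe_add]
    exact add_mem hx hy

theorem idealComponent_mul [GradedRing 𝒜] (h : ∀ ξ : Ξ, 𝒜 ξ * 𝒜 (-ξ) = 𝒜 0)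
    {I J : Ideal A} (hI : IsHomogIdeal 𝒜 I) (hJ : IsHomogIdeal 𝒜 J) (a b : Ξ) :
    idealComponent 𝒜 I a * idealComponent 𝒜 J b = idealComponent 𝒜 (I * J) (a + b) := by
  refine le_antisymm (idealComponent_mul_le I J a b) fun z hz => ?_
  rw [← DirectSum.decompose_of_mem_same 𝒜 hz.2]
  exact decompose_mem_idealComponent_mul h hI hJ a b hz.1

theorem isHomogIdeal_iff_isHomogeneous [GradedRing 𝒜] {I : Ideal A} :
    IsHomogIdeal 𝒜 I ↔ I.IsHomogeneous 𝒜 :=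
  ⟨fun h ξ _ ha => h _ ha ξ, fun h _ ha ξ => h ξ ha⟩

theorem IsHomogIdeal.pow [GradedRing 𝒜] {I : Ideal A} (hI : IsHomogIdeal 𝒜 I) (n : ℕ) :
    IsHomogIdeal 𝒜 (I ^ n) := by
  rw [isHomogIdeal_iff_isHomogeneous] at hI ⊢
  induction n with
  | zero => simpa using Ideal.IsHomogeneous.top 𝒜
  | succ n ih => simpa only [pow_succ] using ih.mul hI

theorem prod_idealComponent [GradedRing 𝒜] (h : ∀ ξ : Ξ, 𝒜 ξ * 𝒜 (-ξ) = 𝒜 0)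
    {I : Ideal A} (hI : IsHomogIdeal 𝒜 I) {n : ℕ} (hn : 1 ≤ n) (ξ : Fin n → Ξ) :
    ∏ i, idealComponent 𝒜 I (ξ i) = idealComponent 𝒜 (I ^ n) (∑ i, ξ i) := by
  induction n, hn using Nat.le_induction with
  | base => simp
  | succ n _ ih =>
    rw [Fin.prod_univ_succ, Fin.sum_univ_succ, ih, pow_succ', idealComponent_mul h hI (hI.pow n)]

theorem grade_mul_grade [GradedRing 𝒜] (h : ∀ ξ : Ξ, 𝒜 ξ * 𝒜 (-ξ) = 𝒜 0) (τ ξ : Ξ) :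
    𝒜 τ * 𝒜 ξ = 𝒜 (τ + ξ) := by
  have htop : IsHomogIdeal 𝒜 ⊤ := fun _ _ _ => Submodule.mem_top
  simpa only [idealComponent_top, Ideal.mul_top] using idealComponent_mul h htop htop τ ξ

end

/-- For a commutative unital ring `A` graded by an abelian group `Ξ`,
the following are equivalent: (i) `A_ξ · A_{−ξ} = A_0` for all `ξ`; (ii) the grading is strong,
`A_τ · A_ξ = A_{τ+ξ}` for all `τ, ξ`; (iii) for every homogeneous ideal `I`, all `n ≥ 1` and
`ξ₁, …, ξₙ ∈ Ξ`, one has `I_{ξ₁} ⋯ I_{ξₙ} = (Iⁿ)_{ξ₁+⋯+ξₙ}`. -/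
theorem gradedRing_strong_tfae [GradedRing 𝒜] :
    ((∀ ξ : Ξ, 𝒜 ξ * 𝒜 (-ξ) = 𝒜 0) ↔ (∀ τ ξ : Ξ, 𝒜 τ * 𝒜 ξ = 𝒜 (τ + ξ))) ∧
    ((∀ ξ : Ξ, 𝒜 ξ * 𝒜 (-ξ) = 𝒜 0) ↔
      (∀ I : Ideal A, IsHomogIdeal 𝒜 I → ∀ n : ℕ, 1 ≤ n → ∀ ξ : Fin n → Ξ,
        (∏ i, idealComponent 𝒜 I (ξ i)) = idealComponent 𝒜 (I ^ n) (∑ i, ξ i))) := by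
  refine ⟨⟨grade_mul_grade, fun h ξ => by rw [h, add_neg_cancel]⟩,
    fun h I hI n hn ξ => prod_idealComponent h hI hn ξ, fun h ξ => ?_⟩
  have := h ⊤ (fun _ _ _ => Submodule.mem_top) 2 one_le_two ![ξ, -ξ]
  simpa [Ideal.top_pow, idealComponent_top] using this
end

section
/- Let k be an algebraically closed field of characteristic 0, g a finite-dimensional semisimple Lie algebra over k, and A a commutative unital k-algebra. Let Γ be a finite abelian group acting on g by Lie algebra automorphisms and on A by k-algebra automorphisms, and suppose the induced action of Γ on the set of maximal ideals of A is free (γ·m = m for a maximal ideal m implies γ = 1). Equip g ⊗_k A with the Lie bracket determined by ⁅u⊗a, v⊗b⁆ = ⁅u,v⁆⊗ab and with the diagonal Γ-action γ·(u⊗a) = (γ·u)⊗(γ·a), and let M = (g⊗A)^Γ be the Lie subalgebra of Γ-fixed points. Then M is perfect: ⁅M,M⁆ = M. -/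
set_option linter.unusedSectionVars false

/-! Equivariant map algebras for free abelian group actions are perfect. -/

open scoped TensorProduct Pointwise

variable (k g A Γ : Type*) [Field k] [IsAlgClosed k] [CharZero k]
  [LieRing g] [LieAlgebra k g] [FiniteDimensional k g] [LieAlgebra.IsSemisimple k g]
  [CommRing A] [Algebra k A]
  [CommGroup Γ] [Finite Γ]
  [DistribMulAction Γ g] [SMulCommClass Γ k g]
  [MulSemiringAction Γ A] [SMulCommClass Γ k A]

namespace EMA

/-- The canonical commutativity equivalence `g ⊗ A ≃ A ⊗ g`. -/
noncomputable def e : g ⊗[k] A ≃ₗ[k] A ⊗[k] g := TensorProduct.comm k g A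

/-- The Lie ring structure on `g ⊗ A` with bracket `⁅u⊗a, v⊗b⁆ = ⁅u,v⁆ ⊗ ab`, obtained by
transporting the base-change Lie algebra structure of `A ⊗ g` along `g ⊗ A ≃ A ⊗ g`. -/
noncomputable instance instLieRingCurrent : LieRing (g ⊗[k] A) :=
  { (inferInstance : AddCommGroup (g ⊗[k] A)) with
    bracket := fun x y => (e k g A).symm ⁅e k g A x, e k g A y⁆
    add_lie := fun x y z => by simp [add_lie]
    lie_add := fun x y z => by simp [lie_add]
    lie_self := fun x => by simp
    leibniz_lie := fun x y z => by simp }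

lemma lie_def (x y : g ⊗[k] A) : ⁅x, y⁆ = (e k g A).symm ⁅e k g A x, e k g A y⁆ := rfl

/-- The bracket on `g ⊗ A` satisfies `⁅u⊗a, v⊗b⁆ = ⁅u,v⁆ ⊗ ab`. -/
lemma lie_tmul (u v : g) (a b : A) :
    ⁅u ⊗ₜ[k] a, v ⊗ₜ[k] b⁆ = ⁅u, v⁆ ⊗ₜ[k] (a * b) := by
  simp [lie_def, e]

noncomputable instance instLieAlgebraCurrent : LieAlgebra k (g ⊗[k] A) where
  lie_smul c x y := by
    simp only [lie_def, map_smul]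
    rw [← algebraMap_smul A c (e k g A y), lie_smul, algebraMap_smul, map_smul]

/-- The diagonal action of `γ ∈ Γ` on `g ⊗ A`, as a `k`-linear map. -/
noncomputable def diagAction (γ : Γ) : g ⊗[k] A →ₗ[k] g ⊗[k] A :=
  TensorProduct.map (DistribMulAction.toLinearMap k g γ) (DistribMulAction.toLinearMap k A γ)

/-- The equivariant map algebra `M = (g ⊗ A)^Γ`: the subspace of `Γ`-fixed points of `g ⊗ A`
under the diagonal action. -/
noncomputable def fixedSubalgebra : Submodule k (g ⊗[k] A) :=
  ⨅ γ : Γ, LinearMap.eqLocus (diagAction k g A Γ γ) LinearMap.id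

end EMA

namespace EMA

/-- The algebra map `A ⊗ A → A` sending `a ⊗ b` to `a * γ • b`. -/
noncomputable def twistedMul (γ : Γ) : A ⊗[k] A →ₐ[k] A :=
  Algebra.TensorProduct.lift (AlgHom.id k A) (MulSemiringAction.toAlgHom k A γ)
    fun _ _ => Commute.all _ _

@[simp]
lemma twistedMul_tmul (γ : Γ) (a b : A) : twistedMul k A Γ γ (a ⊗ₜ b) = a * γ • b := by
  simp [twistedMul]

@[simp]
lemma diagAction_tmul (γ : Γ) (x : g) (a : A) :
    diagAction k g A Γ γ (x ⊗ₜ a) = (γ • x) ⊗ₜ (γ • a) :=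
  rfl

variable {A Γ} in
lemma smul_eq_self_of_forall_sub_smul_mem {γ : Γ} {m : Ideal A}
    (h : ∀ b : A, b - γ • b ∈ m) : γ • m = m := by
  ext b
  rw [Ideal.mem_pointwise_smul_iff_inv_smul_mem]
  have hb := h (γ⁻¹ • b)
  rw [smul_inv_smul] at hb
  exact ⟨fun h => by simpa using m.sub_mem h hb, fun h => by simpa using m.add_mem hb h⟩

/-- For a single `γ` fixing no maximal ideal, the two maps `twistedMul 1` and `twistedMul γ` can
be separated. -/
lemma exists_twistedMul_eq_zero {γ : Γ}
    (hγ : ∀ m : Ideal A, m.IsMaximal → γ • m ≠ m) :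
    ∃ t : A ⊗[k] A, twistedMul k A Γ 1 t = 1 ∧ twistedMul k A Γ γ t = 0 := by
  have hsurj : Function.Surjective (twistedMul k A Γ 1) := fun a => ⟨a ⊗ₜ 1, by simp⟩
  let J : Ideal A := (RingHom.ker (twistedMul k A Γ γ)).map (twistedMul k A Γ 1)
  have hmem (b : A) : b - γ • b ∈ J := by
    have : twistedMul k A Γ 1 (1 ⊗ₜ b - (γ • b) ⊗ₜ 1) ∈ J :=
      Ideal.mem_map_of_mem _ (by simp [RingHom.mem_ker])
    simpa using this
  have hJ : J = ⊤ := by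
    by_contra hne
    obtain ⟨m, hm, hJm⟩ := Ideal.exists_le_maximal J hne
    exact hγ m hm (smul_eq_self_of_forall_sub_smul_mem fun b => hJm (hmem b))
  have h1 : (1 : A) ∈ J := hJ ▸ Submodule.mem_top
  obtain ⟨t, ht, ht1⟩ := (Ideal.mem_map_iff_of_surjective _ hsurj).1 h1
  exact ⟨t, ht1, ht⟩

/-- If `Γ` acts freely on the maximal ideals of `A` then `A` is Galois over its ring of invariants,
in the sense of Chase, Harrison and Rosenberg. -/
lemma exists_twistedMul_eq_ite [Fintype Γ] [DecidableEq Γ]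
    (hfree : ∀ (γ : Γ) (m : Ideal A), m.IsMaximal → γ • m = m → γ = 1) :
    ∃ t : A ⊗[k] A, ∀ γ : Γ, twistedMul k A Γ γ t = if γ = 1 then 1 else 0 := by
  have h (γ : Γ) : ∃ t : A ⊗[k] A, γ ≠ 1 →
      twistedMul k A Γ 1 t = 1 ∧ twistedMul k A Γ γ t = 0 := by
    by_cases hγ : γ = 1
    · exact ⟨0, fun h => absurd hγ h⟩
    · obtain ⟨t, ht⟩ := exists_twistedMul_eq_zero k A Γ (γ := γ)
        fun m hm hmm => hγ (hfree γ m hm hmm)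
      exact ⟨t, fun _ => ht⟩
  choose t ht using h
  refine ⟨∏ γ ∈ Finset.univ.erase 1, t γ, fun γ => ?_⟩
  rw [map_prod]
  split_ifs with hγ
  · subst hγ
    exact Finset.prod_eq_one fun δ hδ => (ht δ (Finset.ne_of_mem_erase hδ)).1
  · exact Finset.prod_eq_zero (Finset.mem_erase.2 ⟨hγ, Finset.mem_univ γ⟩) (ht γ hγ).2

lemma mem_fixedSubalgebra {w : g ⊗[k] A} :
    w ∈ fixedSubalgebra k g A Γ ↔ ∀ γ : Γ, diagAction k g A Γ γ w = w := by
  simp [fixedSubalgebra]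

lemma diagAction_lie (hg : ∀ (γ : Γ) (x y : g), γ • ⁅x, y⁆ = ⁅γ • x, γ • y⁆) (γ : Γ)
    (v w : g ⊗[k] A) :
    diagAction k g A Γ γ ⁅v, w⁆ = ⁅diagAction k g A Γ γ v, diagAction k g A Γ γ w⁆ := by
  induction v with
  | zero => simp
  | add v₁ v₂ h₁ h₂ => simp only [add_lie, map_add, h₁, h₂]
  | tmul x a =>
    induction w with
    | zero => simp
    | add w₁ w₂ h₁ h₂ => simp only [lie_add, map_add, h₁, h₂]
    | tmul y b => simp [lie_tmul, hg, smul_mul']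

lemma lie_mem_fixedSubalgebra (hg : ∀ (γ : Γ) (x y : g), γ • ⁅x, y⁆ = ⁅γ • x, γ • y⁆)
    {v w : g ⊗[k] A} (hv : v ∈ fixedSubalgebra k g A Γ) (hw : w ∈ fixedSubalgebra k g A Γ) :
    ⁅v, w⁆ ∈ fixedSubalgebra k g A Γ := by
  rw [mem_fixedSubalgebra] at *
  intro γ
  rw [diagAction_lie k g A Γ hg, hv, hw]

/-- The sum over `Γ` of the translates of an element of `g ⊗ A`. -/
noncomputable def orbitSum [Fintype Γ] : g ⊗[k] A →ₗ[k] g ⊗[k] A :=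
  ∑ γ : Γ, diagAction k g A Γ γ

lemma orbitSum_tmul [Fintype Γ] (x : g) (a : A) :
    orbitSum k g A Γ (x ⊗ₜ a) = ∑ γ : Γ, (γ • x) ⊗ₜ[k] (γ • a) := by
  simp [orbitSum]

lemma diagAction_diagAction (γ δ : Γ) (w : g ⊗[k] A) :
    diagAction k g A Γ γ (diagAction k g A Γ δ w) = diagAction k g A Γ (γ * δ) w := by
  induction w with
  | zero => simp
  | add v w hv hw => simp only [map_add, hv, hw]
  | tmul x a => simp [mul_smul]

lemma orbitSum_mem_fixedSubalgebra [Fintype Γ] (w : g ⊗[k] A) :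
    orbitSum k g A Γ w ∈ fixedSubalgebra k g A Γ := by
  rw [mem_fixedSubalgebra]
  intro γ
  simp only [orbitSum, LinearMap.sum_apply, map_sum, diagAction_diagAction]
  exact Fintype.sum_equiv (Equiv.mulLeft γ) _ _ fun _ => rfl

lemma lie_orbitSum_tmul [Fintype Γ] (hg : ∀ (γ : Γ) (x y : g), γ • ⁅x, y⁆ = ⁅γ • x, γ • y⁆)
    (x y : g) (a b : A) :
    ⁅orbitSum k g A Γ (x ⊗ₜ a), orbitSum k g A Γ (y ⊗ₜ b)⁆ =
      ∑ δ : Γ, orbitSum k g A Γ (⁅x, δ • y⁆ ⊗ₜ (a * δ • b)) := by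
  simp only [orbitSum_tmul, sum_lie, lie_sum, lie_tmul]
  rw [Finset.sum_comm]
  conv_rhs => rw [Finset.sum_comm]
  refine Finset.sum_congr rfl fun γ _ => ?_
  refine (Fintype.sum_equiv (Equiv.mulLeft γ) _ _ fun δ => ?_).symm
  simp [hg, mul_smul, smul_mul']

/-- A semisimple Lie algebra is perfect. -/
lemma span_lie_eq_top : Submodule.span k {z : g | ∃ x y : g, ⁅x, y⁆ = z} = ⊤ := by
  have h : (⊤ : LieIdeal k g) ≤ ⁅(⊤ : LieIdeal k g), (⊤ : LieIdeal k g)⁆ := by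
    rw [← LieAlgebra.IsSemisimple.sSup_atoms_eq_top (R := k) (L := g)]
    refine sSup_le fun I hI => ?_
    rw [← lie_eq_self_of_isAtom_of_nonabelian I hI
      (LieAlgebra.IsSemisimple.non_abelian_of_isAtom I hI)]
    exact LieSubmodule.mono_lie (le_sSup hI) (le_sSup hI)
  have h' := congrArg LieSubmodule.toSubmodule (top_le_iff.1 h)
  rw [LieSubmodule.lieIdeal_oper_eq_linear_span'] at h'
  simpa using h'

variable {k g A Γ} in
/-- Every orbit sum is a linear combination of brackets of invariants. -/
lemma orbitSum_mem_span_lie [Fintype Γ] [DecidableEq Γ]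
    (hg : ∀ (γ : Γ) (x y : g), γ • ⁅x, y⁆ = ⁅γ • x, γ • y⁆)
    (hfree : ∀ (γ : Γ) (m : Ideal A), m.IsMaximal → γ • m = m → γ = 1) (w : g ⊗[k] A) :
    orbitSum k g A Γ w ∈ Submodule.span k
      {w : g ⊗[k] A | ∃ x ∈ fixedSubalgebra k g A Γ,
        ∃ y ∈ fixedSubalgebra k g A Γ, w = ⁅x, y⁆} := by
  set S := Submodule.span k {w : g ⊗[k] A | ∃ x ∈ fixedSubalgebra k g A Γ,
    ∃ y ∈ fixedSubalgebra k g A Γ, w = ⁅x, y⁆}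
  have key (x y : g) (c : A) (t : A ⊗[k] A) :
      ∑ δ : Γ, orbitSum k g A Γ (⁅x, δ • y⁆ ⊗ₜ (c * twistedMul k A Γ δ t)) ∈ S := by
    induction t with
    | zero => simp
    | add t₁ t₂ h₁ h₂ =>
      simp only [map_add, mul_add, TensorProduct.tmul_add, Finset.sum_add_distrib]
      exact S.add_mem h₁ h₂
    | tmul a b =>
      simp only [twistedMul_tmul, ← mul_assoc]
      rw [← lie_orbitSum_tmul k g A Γ hg]
      exact Submodule.subset_span ⟨_, orbitSum_mem_fixedSubalgebra k g A Γ _, _,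
        orbitSum_mem_fixedSubalgebra k g A Γ _, rfl⟩
  obtain ⟨t, ht⟩ := exists_twistedMul_eq_ite k A Γ hfree
  have hlie (x y : g) (c : A) : orbitSum k g A Γ (⁅x, y⁆ ⊗ₜ c) ∈ S := by
    have h := key x y c t
    rwa [Finset.sum_eq_single 1 (fun δ _ hδ => by simp [ht, hδ]) (by simp), ht, if_pos rfl,
      one_smul, mul_one] at h
  induction w with
  | zero => simp
  | add v w hv hw => rw [map_add]; exact S.add_mem hv hw
  | tmul z c =>
    have hz : z ∈ Submodule.span k {z : g | ∃ x y : g, ⁅x, y⁆ = z} :=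
      span_lie_eq_top k g ▸ Submodule.mem_top
    induction hz using Submodule.span_induction with
    | mem z hz => obtain ⟨x, y, rfl⟩ := hz; exact hlie x y c
    | zero => simp
    | add z₁ z₂ _ _ h₁ h₂ => rw [TensorProduct.add_tmul, map_add]; exact S.add_mem h₁ h₂
    | smul r z _ h => rw [← TensorProduct.smul_tmul', map_smul]; exact S.smul_mem r h

end EMA

/-- Let `g` be finite-dimensional semisimple, `Γ` a finite abelian group
acting on `g` by Lie algebra automorphisms and on `A` by `k`-algebra automorphisms, acting
freely on the set of maximal ideals of `A`.  Then the equivariant map algebra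
`M = (g ⊗ A)^Γ` is perfect: `⁅M,M⁆ = M`. -/
theorem equivariantMapAlgebra_perfect
    (hg : ∀ (γ : Γ) (x y : g), γ • ⁅x, y⁆ = ⁅γ • x, γ • y⁆)
    (hfree : ∀ (γ : Γ) (m : Ideal A), m.IsMaximal → γ • m = m → γ = 1) :
    Submodule.span k
        {w : g ⊗[k] A | ∃ x ∈ EMA.fixedSubalgebra k g A Γ,
          ∃ y ∈ EMA.fixedSubalgebra k g A Γ, w = ⁅x, y⁆} =
      EMA.fixedSubalgebra k g A Γ := by
  classical
  have := Fintype.ofFinite Γ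
  refine le_antisymm (Submodule.span_le.2 ?_) fun w hw => ?_
  · rintro _ ⟨x, hx, y, hy, rfl⟩
    exact EMA.lie_mem_fixedSubalgebra k g A Γ hg hx hy
  have hcard : (Fintype.card Γ : k) ≠ 0 := Nat.cast_ne_zero.2 Fintype.card_ne_zero
  have hsum : EMA.orbitSum k g A Γ w = (Fintype.card Γ : k) • w := by
    simp [EMA.orbitSum, (EMA.mem_fixedSubalgebra k g A Γ).1 hw, Nat.cast_smul_eq_nsmul]
  rw [← inv_smul_smul₀ hcard w, ← hsum]
  exact Submodule.smul_mem _ _ (EMA.orbitSum_mem_span_lie hg hfree w)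
end

section
/- Let k be an algebraically closed field of characteristic 0 and l a finite-dimensional Lie algebra over k. Let U be a finite-dimensional completely reducible l-module (a direct sum of irreducible submodules), let V and W be irreducible finite-dimensional l-modules, and suppose that Hom_l(U^{⊗m} ⊗ V, W) ≠ 0 for some integer m ≥ 1. Then there exists a sequence V₀, V₁, …, V_m of irreducible finite-dimensional l-modules with V₀ ≅ V, V_m ≅ W, and Hom_l(U ⊗ V_i, V_{i+1}) ≠ 0 for all 0 ≤ i < m. -/
/-! Chains of irreducible modules linked through a completely reducible module. -/

open scoped TensorProduct

universe u

/-- A bundled finite-dimensional-free package of a Lie module over `l`. -/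
structure LieModuleBundle (k l : Type u) [Field k] [LieRing l] [LieAlgebra k l] :
    Type (u + 1) where
  carrier : Type u
  [addCommGroup : AddCommGroup carrier]
  [module : Module k carrier]
  [lieRingModule : LieRingModule l carrier]
  [lieModule : LieModule k l carrier]

attribute [instance] LieModuleBundle.addCommGroup LieModuleBundle.module
  LieModuleBundle.lieRingModule LieModuleBundle.lieModule

variable (k l U V W : Type u) [Field k] [IsAlgClosed k] [CharZero k]
  [LieRing l] [LieAlgebra k l] [FiniteDimensional k l]
  [AddCommGroup U] [Module k U] [LieRingModule l U] [LieModule k l U]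
  [AddCommGroup V] [Module k V] [LieRingModule l V] [LieModule k l V]
  [AddCommGroup W] [Module k W] [LieRingModule l W] [LieModule k l W]

/-- The iterated tensor product `U^{⊗n} ⊗ V`, realized recursively as
`Y 0 = V`, `Y (n+1) = U ⊗ (Y n)` with the diagonal `l`-action at each step. -/
noncomputable def tensorPowTensor : ℕ → LieModuleBundle k l
  | 0 => ⟨V⟩
  | n + 1 => ⟨U ⊗[k] (tensorPowTensor n).carrier⟩

namespace LieModule

open LieAlgebra Module

section Weyl

variable {K L : Type*} [Field K] [CharZero K] [LieRing L] [LieAlgebra K L]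
  [FiniteDimensional K L]

/-- A semisimple Lie algebra is perfect. -/
lemma derivedIdeal_eq_top [HasTrivialRadical K L] :
    ⁅(⊤ : LieIdeal K L), (⊤ : LieIdeal K L)⁆ = ⊤ := by
  set I : LieIdeal K L := ⁅(⊤ : LieIdeal K L), (⊤ : LieIdeal K L)⁆ with hI
  have hcompl := LieIdeal.isCompl_killingCompl I
  suffices I.killingCompl = ⊥ by simpa [this] using hcompl.sup_eq_top
  refine (LieSubmodule.eq_bot_iff _).mpr fun x hx ↦ ?_
  have hcenter : x ∈ center K L := by
    refine (mem_maxTrivSubmodule K L L x).mpr fun y ↦ ?_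
    refine (IsKilling.killingForm_nondegenerate K L).1 _ fun z ↦ ?_
    rw [← lie_skew, map_neg, LinearMap.neg_apply, traceForm_apply_lie_apply, traceForm_comm,
      neg_eq_zero]
    exact (LieIdeal.mem_killingCompl K L I).mp hx _
      (LieSubmodule.lie_mem_lie (LieSubmodule.mem_top y) (LieSubmodule.mem_top z))
  simpa using hcenter

variable {E : Type*} [AddCommGroup E] [Module K E] [LieRingModule L E] [LieModule K L E]
  [FiniteDimensional K E]

/-- A module of a semisimple Lie algebra with vanishing trace form is trivial. -/
lemma isTrivial_of_traceForm_eq_zero_s12 [HasTrivialRadical K L] (h : traceForm K L E = 0) :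
    IsTrivial L E := by
  have hnil := isNilpotent_derivedSeries_of_traceForm_eq_zero h
  have hnilL : IsNilpotent L E := by
    rw [isNilpotent_iff_forall' (R := K)] at hnil ⊢
    intro x
    have hx : x ∈ derivedSeries K L 1 := by
      rw [derivedSeries_def, derivedSeriesOfIdeal_succ, derivedSeriesOfIdeal_zero,
        derivedIdeal_eq_top]
      exact LieSubmodule.mem_top x
    exact hnil ⟨x, hx⟩
  have hle : ⁅(⊤ : LieIdeal K L), (⊤ : LieSubmodule K L E)⁆ ≤
      ⁅(⊤ : LieIdeal K L), ⁅(⊤ : LieIdeal K L), (⊤ : LieSubmodule K L E)⁆⁆ := by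
    rw [LieSubmodule.lie_le_iff]
    intro x hx m hm
    rw [← derivedIdeal_eq_top (K := K) (L := L), ← LieSubmodule.mem_toSubmodule,
      LieSubmodule.lieIdeal_oper_eq_linear_span'] at hx
    induction hx using Submodule.span_induction with
    | mem z hz =>
      obtain ⟨u, hu, v, hv, rfl⟩ := hz
      rw [lie_lie]
      exact sub_mem (LieSubmodule.lie_mem_lie hu (LieSubmodule.lie_mem_lie hv hm))
        (LieSubmodule.lie_mem_lie hv (LieSubmodule.lie_mem_lie hu hm))
    | zero => simp
    | add u v _ _ hu hv => rw [add_lie]; exact add_mem hu hv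
    | smul t u _ hu => rw [smul_lie]; exact SMulMemClass.smul_mem t hu
  have hlcs (n : ℕ) : ⁅(⊤ : LieIdeal K L), (⊤ : LieSubmodule K L E)⁆ ≤
      lowerCentralSeries K L E n := by
    induction n with
    | zero => simp
    | succ n ih =>
      rw [lowerCentralSeries_succ]
      exact hle.trans (LieSubmodule.mono_lie_right _ ih)
  obtain ⟨n, hn⟩ := (isNilpotent_iff K L E).mp hnilL
  have hbot := le_bot_iff.mp (hn ▸ hlcs n)
  exact ⟨fun x m ↦ (LieSubmodule.lie_eq_bot_iff _ _).mp hbot x (LieSubmodule.mem_top x) m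
    (LieSubmodule.mem_top m)⟩

omit [FiniteDimensional K E] in
/-- If the trace form of a module does not vanish, the module has a Casimir endomorphism with nonzero
trace. -/
lemma exists_casimir [HasTrivialRadical K L] (h : traceForm K L E ≠ 0) :
    ∃ Ω : E →ₗ⁅K,L⁆ E, Ω.range ≤ ⁅(⊤ : LieIdeal K L), (⊤ : LieSubmodule K L E)⁆ ∧
      LinearMap.trace K E (Ω : E →ₗ[K] E) ≠ 0 := by
  set β := traceForm K L E with hβ
  let N : LieIdeal K L :=
    InvariantForm.orthogonal β (traceForm_lieInvariant K L E) ⊤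
  have hN {x : L} : x ∈ N ↔ ∀ y, β x y = 0 := by
    simp [N, InvariantForm.mem_orthogonal, traceForm_comm K L E, β]
  let J : LieIdeal K L := N.killingCompl
  have hNJ : IsCompl N J := LieIdeal.isCompl_killingCompl N
  let B : LinearMap.BilinForm K J := β.restrict J.toSubmodule
  have hBsymm : B.IsSymm := ⟨fun x y ↦ traceForm_comm K L E x y⟩
  have hB : B.Nondegenerate := by
    refine hBsymm.isRefl.nondegenerate_iff_separatingLeft.mpr fun x hx ↦ ?_
    have : (x : L) ∈ N := hN.mpr fun y ↦ by
      obtain ⟨a, ha, b, hb, rfl⟩ := (LieSubmodule.mem_sup N J y).mp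
        (hNJ.sup_eq_top ▸ LieSubmodule.mem_top y)
      rw [map_add, show β x b = 0 from hx ⟨b, hb⟩, traceForm_comm, hN.mp ha, add_zero]
    have := (hNJ.disjoint.le_bot ⟨this, x.2⟩ : (x : L) ∈ (⊥ : LieIdeal K L))
    simpa using this
  let b := finBasis K J
  let d := B.dualBasis hB b
  let ρ := toEnd K L E
  have hbd (i j) : β (b i) (d j) = if i = j then 1 else 0 :=
    B.apply_dualBasis_right hB hBsymm b i j
  have expand_b {y : L} (hy : y ∈ J) : y = ∑ j, β y (d j) • (b j : L) := by
    lift y to J using hy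
    have h (j) : b.repr y j = β y (d j) := by
      rw [← B.dualBasis_dualBasis hB hBsymm b, B.dualBasis_repr_apply]
      rfl
    conv_lhs => rw [← b.sum_repr y]
    simp [h]
  have expand_d {y : L} (hy : y ∈ J) : y = ∑ j, β y (b j) • (d j : L) := by
    lift y to J using hy
    have h (j) : d.repr y j = β y (b j) := B.dualBasis_repr_apply hB b y j
    conv_lhs => rw [← d.sum_repr y]
    simp [h]
  let Ω : End K E := ∑ i, ρ (b i) * ρ (d i)
  have hΩ (x : L) : ρ x * Ω = Ω * ρ x := by
    let c (i j) : K := β ⁅x, (b i : L)⁆ (d j)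
    have hρ (y : L) : ρ x * ρ y = ρ ⁅x, y⁆ + ρ y * ρ x := by
      ext m
      simp [ρ]
    have hb (i) : ρ x * ρ (b i) = ∑ j, c i j • ρ (b j) + ρ (b i) * ρ x := by
      rw [hρ, expand_b (J.lie_mem (b i).2 : ⁅x, (b i : L)⁆ ∈ J), map_sum]
      simp [c]
    have hd (i) : ρ x * ρ (d i) = -∑ j, c j i • ρ (d j) + ρ (d i) * ρ x := by
      have hc (j) : β ⁅x, (d i : L)⁆ (b j) = -c j i := by
        rw [← lie_skew, map_neg, LinearMap.neg_apply, hβ, traceForm_apply_lie_apply,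
          traceForm_comm]
      rw [hρ, expand_d (J.lie_mem (d i).2 : ⁅x, (d i : L)⁆ ∈ J), map_sum]
      simp [hc]
    calc ρ x * Ω = ∑ i, (ρ x * ρ (b i)) * ρ (d i) := by simp [Ω, Finset.mul_sum, mul_assoc]
      _ = ∑ i, ∑ j, c i j • (ρ (b j) * ρ (d i)) + ∑ i, ρ (b i) * (ρ x * ρ (d i)) := by
        simp [hb, add_mul, Finset.sum_mul, Finset.sum_add_distrib, mul_assoc]
      _ = Ω * ρ x := by
        simp only [hd, mul_add, mul_neg, Finset.mul_sum, Finset.sum_add_distrib,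
          Finset.sum_neg_distrib, mul_smul_comm]
        rw [Finset.sum_comm, add_neg_cancel_left]
        simp [Ω, Finset.sum_mul, mul_assoc]
  refine ⟨{ Ω with map_lie' := fun {x m} ↦ (LinearMap.congr_fun (hΩ x) m).symm }, ?_, ?_⟩
  · rintro _ ⟨m, rfl⟩
    change Ω m ∈ _
    rw [LinearMap.sum_apply]
    exact sum_mem fun i _ ↦
      LieSubmodule.lie_mem_lie (LieSubmodule.mem_top _) (LieSubmodule.mem_top _)
  · have htr : LinearMap.trace K E Ω = finrank K J := by
      have htr (i) : LinearMap.trace K E (ρ (b i) * ρ (d i)) = 1 := by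
        exact (hbd i i).trans (if_pos rfl)
      simp [Ω, htr]
    change LinearMap.trace K E Ω ≠ 0
    rw [htr, Nat.cast_ne_zero]
    intro h0
    refine h (LinearMap.ext fun x ↦ LinearMap.ext fun y ↦ ?_)
    have hJ : J = ⊥ := by
      rw [← LieSubmodule.toSubmodule_eq_bot]
      exact Submodule.finrank_eq_zero.mp h0
    have hNtop : N = ⊤ := by simpa [hJ] using hNJ.sup_eq_top
    exact hN.mp (hNtop ▸ LieSubmodule.mem_top x) y

/-- Every finite-dimensional module over a semisimple Lie algebra in characteristic zero is spanned
by its invariants together with the image of the action. -/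
theorem maxTrivSubmodule_sup_lie_top [HasTrivialRadical K L] :
    maxTrivSubmodule K L E ⊔ ⁅(⊤ : LieIdeal K L), (⊤ : LieSubmodule K L E)⁆ = ⊤ := by
  induction hn : finrank K E using Nat.strong_induction_on generalizing E with
  | _ n ih =>
  by_cases hE : traceForm K L E = 0
  · have := isTrivial_of_traceForm_eq_zero_s12 hE
    rw [(isTrivial_iff_max_triv_eq_top K L E).mp this, top_sup_eq]
  obtain ⟨Ω, hΩ, htr⟩ := exists_casimir hE
  obtain ⟨m, hm, hm1⟩ := ((Ω : E →ₗ[K] E).eventually_isCompl_ker_pow_range_pow.and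
    (Filter.eventually_ge_atTop 1)).exists
  have hcomm (x : L) (r : ℕ) (v : E) :
      ((Ω : E →ₗ[K] E) ^ r) ⁅x, v⁆ = ⁅x, ((Ω : E →ₗ[K] E) ^ r) v⁆ := by
    induction r with
    | zero => simp
    | succ r ihr => rw [pow_succ', Module.End.mul_apply, ihr]; simp
  let E₀ : LieSubmodule K L E :=
    { LinearMap.ker ((Ω : E →ₗ[K] E) ^ m) with
      lie_mem := fun {x v} hv ↦ by
        change ((Ω : E →ₗ[K] E) ^ m) ⁅x, v⁆ = 0
        rw [hcomm, show ((Ω : E →ₗ[K] E) ^ m) v = 0 from hv, lie_zero] }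
  have hlt : finrank K E₀ < n := by
    rw [← hn]
    refine Submodule.finrank_lt (s := E₀.toSubmodule) fun h ↦ htr ?_
    have hnil : _root_.IsNilpotent (Ω : E →ₗ[K] E) := ⟨m, LinearMap.ker_eq_top.mp h⟩
    exact (LinearMap.isNilpotent_trace_of_isNilpotent hnil).eq_zero
  have key := ih _ hlt (E := E₀) rfl
  refine eq_top_iff.mpr fun v _ ↦ ?_
  obtain ⟨a, ha, _, ⟨w, rfl⟩, rfl⟩ :=
    Submodule.mem_sup.mp (hm.sup_eq_top ▸ Submodule.mem_top (x := v))
  refine add_mem ?_ (LieSubmodule.mem_sup_right (hΩ ?_))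
  · obtain ⟨p, hp, q, hq, hpq⟩ := (LieSubmodule.mem_sup _ _ _).mp
      (key ▸ LieSubmodule.mem_top (⟨a, ha⟩ : E₀))
    obtain rfl : (p : E) + q = a := congrArg Subtype.val hpq
    refine add_mem (LieSubmodule.mem_sup_left ?_) (LieSubmodule.mem_sup_right ?_)
    · exact (mem_maxTrivSubmodule K L E _).mpr fun x ↦
        congrArg Subtype.val ((mem_maxTrivSubmodule K L E₀ p).mp hp x)
    · have := LieSubmodule.mem_map_of_mem (f := E₀.incl) hq
      rw [LieSubmodule.map_bracket_eq] at this
      exact LieSubmodule.mono_lie_right _ le_top this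
  · obtain ⟨s, rfl⟩ := Nat.exists_eq_add_of_le' hm1
    rw [pow_succ']
    exact ⟨_, rfl⟩

/-- **Weyl's theorem** on complete reducibility, in terms of equivariant retractions. -/
theorem exists_retraction [HasTrivialRadical K L] (P : LieSubmodule K L E) :
    ∃ r : E →ₗ⁅K,L⁆ P, ∀ v : P, r v = v := by
  let S : LieSubmodule K L (E →ₗ[K] P) :=
    { carrier := {g | ∃ c : K, ∀ v : P, g v = c • v}
      add_mem' := by
        rintro f g ⟨c, hc⟩ ⟨d, hd⟩
        exact ⟨c + d, fun v ↦ by simp [hc, hd, add_smul]⟩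
      zero_mem' := ⟨0, by simp⟩
      smul_mem' := by
        rintro t f ⟨c, hc⟩
        exact ⟨t * c, fun v ↦ by simp [hc, mul_smul]⟩
      lie_mem := by
        rintro x f ⟨c, hc⟩
        refine ⟨0, fun v ↦ ?_⟩
        rw [LieHom.lie_apply, ← LieSubmodule.coe_bracket, hc, hc, lie_smul]
        simp }
  have hvanish (f : S) (hf : f ∈ ⁅(⊤ : LieIdeal K L), (⊤ : LieSubmodule K L S)⁆) (v : P) :
      (f : E →ₗ[K] P) v = 0 := by
    rw [← LieSubmodule.mem_toSubmodule, LieSubmodule.lieIdeal_oper_eq_linear_span'] at hf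
    induction hf using Submodule.span_induction with
    | mem z hz =>
      obtain ⟨x, -, ⟨g, c, hc⟩, -, rfl⟩ := hz
      rw [LieSubmodule.coe_bracket, LieHom.lie_apply, ← LieSubmodule.coe_bracket, hc, hc, lie_smul,
        sub_self]
    | zero => simp
    | add f g _ _ hf hg => simp [hf, hg]
    | smul t f _ hf => simp [hf]
  obtain ⟨g, hg⟩ := P.toSubmodule.subtype.exists_leftInverse_of_injective P.toSubmodule.ker_subtype
  replace hg (v : P) : g v = v := LinearMap.congr_fun hg v
  obtain ⟨e, he, t, ht, het⟩ := (LieSubmodule.mem_sup _ _ _).mp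
    (maxTrivSubmodule_sup_lie_top (K := K) (L := L) (E := S) ▸
      LieSubmodule.mem_top (⟨g, 1, fun v ↦ by rw [hg, one_smul]⟩ : S))
  refine ⟨maxTrivLinearMapEquivLieModuleHom ⟨e, fun x ↦ congrArg Subtype.val (he x)⟩, fun v ↦ ?_⟩
  have := LinearMap.congr_fun (congrArg Subtype.val het) (v : E)
  simpa [hvanish t ht, hg] using this

end Weyl

section Irreducible

attribute [local instance] LieRing.ofAssociativeRing

variable {K L M N : Type*} [Field K] [CharZero K] [IsAlgClosed K] [LieRing L] [LieAlgebra K L]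
  [AddCommGroup M] [Module K M] [LieRingModule L M] [LieModule K L M] [FiniteDimensional K M]
  [AddCommGroup N] [Module K N] [LieRingModule L N] [LieModule K L N] [FiniteDimensional K N]

/-- On an irreducible module where every element has trace zero, the radical acts trivially. -/
lemma toEnd_eq_zero_of_mem_radical [FiniteDimensional K L] [IsIrreducible K L M]
    (h : ∀ x : L, LinearMap.trace K M (toEnd K L M x) = 0) {x : L} (hx : x ∈ radical K L) :
    toEnd K L M x = 0 := by
  have := nontrivial_of_isIrreducible K L M
  obtain ⟨χ, hχ⟩ : ∃ χ : Module.Dual K (radical K L), Nontrivial (weightSpace M χ) :=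
    exists_nontrivial_weightSpace_of_isSolvable K (radical K L) M
  let W : LieSubmodule K L M := weightSpaceOfIsLieTower K M χ
  have : Nontrivial W := hχ
  have hW : W = ⊤ := W.eq_top_of_isIrreducible K L M
  have hscalar : toEnd K L M x = χ ⟨x, hx⟩ • 1 := by
    ext m
    have hm : ∀ (y : L) (hy : y ∈ radical K L), ⁅y, m⁆ = χ ⟨y, hy⟩ • m := by
      simpa [W, weightSpaceOfIsLieTower, mem_weightSpace] using (hW ▸ LieSubmodule.mem_top m : m ∈ W)
    simpa using hm x hx
  have htr := h x
  rw [hscalar, map_smul, LinearMap.trace_one, smul_eq_mul, mul_eq_zero, Nat.cast_eq_zero] at htr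
  rw [hscalar, htr.resolve_right (finrank_pos (R := K) (M := M)).ne', zero_smul]

variable (K L M) in
/-- The action of a Lie algebra on a module, corrected by scalars to have trace zero. -/
noncomputable def tracefreeToEnd : L →ₗ⁅K⁆ End K M where
  toFun x := toEnd K L M x - ((finrank K M : K)⁻¹ * LinearMap.trace K M (toEnd K L M x)) • 1
  map_add' x y := by simp only [map_add, mul_add, add_smul]; abel
  map_smul' t x := by
    simp only [map_smul, smul_eq_mul, RingHom.id_apply, smul_sub, smul_smul]
    ring_nf
  map_lie' {x y} := by
    ext m
    simp

omit [IsAlgClosed K] in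
lemma trace_tracefreeToEnd [Nontrivial M] (x : L) :
    LinearMap.trace K M (tracefreeToEnd K L M x) = 0 := by
  have : (finrank K M : K) ≠ 0 := Nat.cast_ne_zero.mpr (finrank_pos (R := K) (M := M)).ne'
  change LinearMap.trace K M (toEnd K L M x - _ • (1 : End K M)) = 0
  rw [map_sub, map_smul, LinearMap.trace_one, smul_eq_mul]
  field_simp
  simp

omit [CharZero K] [IsAlgClosed K] [LieAlgebra K L] [LieModule K L M] [FiniteDimensional K M] in
/-- An irreducible module stays irreducible over any Lie algebra acting by the same operators up to
scalars. -/
lemma IsIrreducible.of_lie_eq_add_smul [IsIrreducible K L M] {L' : Type*} [LieRing L']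
    [LieAlgebra K L'] [LieRingModule L' M] [LieModule K L' M]
    (h : ∀ x : L, ∃ (y : L') (c : K), ∀ m : M, ⁅x, m⁆ = ⁅y, m⁆ + c • m) :
    IsIrreducible K L' M := by
  have := nontrivial_of_isIrreducible K L M
  refine .mk fun P hP ↦ ?_
  let Q : LieSubmodule K L M :=
    { P.toSubmodule with
      lie_mem := fun {x m} hm ↦ by
        obtain ⟨y, c, hyc⟩ := h x
        rw [hyc]
        exact P.add_mem (P.lie_mem hm) (P.smul_mem c hm) }
  have hQ : Q ≠ ⊥ := fun hQ ↦ hP <| by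
    rwa [← LieSubmodule.toSubmodule_eq_bot] at hQ ⊢
  have := (eq_bot_or_eq_top Q).resolve_left hQ
  rwa [← LieSubmodule.toSubmodule_eq_top] at this ⊢

/-- Submodules of the space of linear maps between irreducible modules admit equivariant
retractions. -/
theorem exists_retraction_linearMap [IsIrreducible K L M] [IsIrreducible K L N]
    (P : LieSubmodule K L (M →ₗ[K] N)) :
    ∃ r : (M →ₗ[K] N) →ₗ⁅K,L⁆ P, ∀ f : P, r f = f := by
  have := nontrivial_of_isIrreducible K L M
  have := nontrivial_of_isIrreducible K L N
  let φ : L →ₗ⁅K⁆ End K M × End K N := (tracefreeToEnd K L M).prod (tracefreeToEnd K L N)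
  let S : LieSubalgebra K (End K M × End K N) := φ.range
  let f₁ : S →ₗ⁅K⁆ End K M := (LieHom.fst K _ _).comp S.incl
  let f₂ : S →ₗ⁅K⁆ End K N := (LieHom.snd K _ _).comp S.incl
  let _ : LieRingModule S M := LieRingModule.compLieHom M f₁
  let _ : LieModule K S M := LieModule.compLieHom M f₁
  let _ : LieRingModule S N := LieRingModule.compLieHom N f₂
  let _ : LieModule K S N := LieModule.compLieHom N f₂
  have hM (x : L) (m : M) : ⁅x, m⁆ = ⁅φ.rangeRestrict x, m⁆ +
      ((finrank K M : K)⁻¹ * LinearMap.trace K M (toEnd K L M x)) • m :=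
    (sub_add_cancel _ _).symm
  have hN (x : L) (n : N) : ⁅x, n⁆ = ⁅φ.rangeRestrict x, n⁆ +
      ((finrank K N : K)⁻¹ * LinearMap.trace K N (toEnd K L N x)) • n :=
    (sub_add_cancel _ _).symm
  have : IsIrreducible K S M := .of_lie_eq_add_smul fun x ↦ ⟨_, _, hM x⟩
  have : IsIrreducible K S N := .of_lie_eq_add_smul fun x ↦ ⟨_, _, hN x⟩
  have : HasTrivialRadical K S := ⟨(LieSubmodule.eq_bot_iff _).mpr fun y hy ↦ by
    have h₁ : toEnd K S M y = 0 := toEnd_eq_zero_of_mem_radical (by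
      rintro ⟨_, x, rfl⟩
      exact trace_tracefreeToEnd x) hy
    have h₂ : toEnd K S N y = 0 := toEnd_eq_zero_of_mem_radical (by
      rintro ⟨_, x, rfl⟩
      exact trace_tracefreeToEnd x) hy
    exact Subtype.ext (Prod.ext h₁ h₂)⟩
  have hHom (x : L) : ∃ c : K, ∀ f : M →ₗ[K] N, ⁅φ.rangeRestrict x, f⁆ = ⁅x, f⁆ - c • f := by
    refine ⟨(finrank K N : K)⁻¹ * LinearMap.trace K N (toEnd K L N x) -
      (finrank K M : K)⁻¹ * LinearMap.trace K M (toEnd K L M x), fun f ↦ ?_⟩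
    ext m
    simp only [LieHom.lie_apply, LinearMap.sub_apply, LinearMap.smul_apply, hM, hN, map_add,
      map_smul]
    module
  let P' : LieSubmodule K S (M →ₗ[K] N) :=
    { P.toSubmodule with
      lie_mem := by
        rintro ⟨_, x, rfl⟩ f hf
        obtain ⟨c, hc⟩ := hHom x
        exact (hc f) ▸ P.sub_mem (P.lie_mem hf) (P.smul_mem c hf) }
  obtain ⟨r, hr⟩ := exists_retraction P'
  refine ⟨{ toLinearMap := (r : (M →ₗ[K] N) →ₗ[K] P'), map_lie' := fun {x f} ↦ ?_ }, hr⟩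
  obtain ⟨c, hc⟩ := hHom x
  have h : r ⁅x, f⁆ = ⁅φ.rangeRestrict x, r f⁆ + c • r f := by
    rw [← LieModuleHom.map_lie, hc, map_sub, map_smul, sub_add_cancel]
  refine Subtype.ext ((congrArg Subtype.val h).trans ?_)
  change ⁅φ.rangeRestrict x, (r f : M →ₗ[K] N)⁆ + c • (r f : M →ₗ[K] N) =
    ⁅x, (r f : M →ₗ[K] N)⁆
  rw [hc, sub_add_cancel]

end Irreducible
end LieModule

open LieModule

section Chain

variable {K L : Type*} [Field K] [LieRing L] [LieAlgebra K L]

section Homs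

variable {M N P : Type*}
  [AddCommGroup M] [Module K M] [LieRingModule L M] [LieModule K L M]
  [AddCommGroup N] [Module K N] [LieRingModule L N] [LieModule K L N]
  [AddCommGroup P] [Module K P] [LieRingModule L P] [LieModule K L P]

/-- Exchange the arguments of an equivariant map into a space of linear maps. -/
def LieModuleHom.flip (F : M →ₗ⁅K,L⁆ N →ₗ[K] P) : N →ₗ⁅K,L⁆ M →ₗ[K] P where
  toLinearMap := (F : M →ₗ[K] N →ₗ[K] P).flip
  map_lie' {x n} := by
    ext m
    simp [LieHom.lie_apply]

@[simp]
lemma LieModuleHom.flip_apply (F : M →ₗ⁅K,L⁆ N →ₗ[K] P) (m : M) (n : N) : F.flip n m = F m n :=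
  rfl

omit [LieAlgebra K L] [LieModule K L M] [LieModule K L N] in
/-- **Schur's lemma**: a nonzero map between irreducible modules is an isomorphism. -/
lemma LieModuleHom.nonempty_equiv_of_ne_zero [IsIrreducible K L M] [IsIrreducible K L N]
    {f : M →ₗ⁅K,L⁆ N} (hf : f ≠ 0) : Nonempty (M ≃ₗ⁅K,L⁆ N) := by
  have hker : f.ker = ⊥ := (eq_bot_or_eq_top f.ker).resolve_right fun h ↦ hf <| by
    ext m
    exact f.mem_ker.mp (h ▸ LieSubmodule.mem_top m)
  have hrange : f.range = ⊤ := (eq_bot_or_eq_top f.range).resolve_left fun h ↦ hf <| by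
    ext m
    exact (LieSubmodule.mem_bot _).mp (h ▸ f.mem_range (f m) |>.mpr ⟨m, rfl⟩)
  exact ⟨{ LinearEquiv.ofBijective (f : M →ₗ[K] N)
    ⟨f.ker_eq_bot.mp hker, f.range_eq_top.mp hrange⟩ with map_lie' := f.map_lie' }⟩

omit [LieAlgebra K L] [LieModule K L M] in
/-- Atoms of the lattice of Lie submodules are irreducible. -/
lemma LieSubmodule.isIrreducible_of_isAtom {A : LieSubmodule K L M} (hA : IsAtom A) :
    IsIrreducible K L A := by
  have : Nontrivial A := (LieSubmodule.nontrivial_iff_ne_bot K L M).mpr hA.1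
  refine .mk fun B hB ↦ ?_
  have hle : B.map A.incl ≤ A := by
    rintro _ ⟨b, -, rfl⟩
    exact b.2
  have h := (hA.le_iff.mp hle).resolve_left fun h ↦ hB <| by
    refine (LieSubmodule.eq_bot_iff _).mpr fun b hb ↦ Subtype.ext ?_
    exact (LieSubmodule.mem_bot (R := K) (L := L) _).mp
      (h ▸ LieSubmodule.mem_map_of_mem (f := A.incl) hb)
  refine eq_top_iff.mpr fun a _ ↦ ?_
  obtain ⟨b, hb, hba⟩ := (LieSubmodule.mem_map _).mp (h.ge a.2)
  exact (Subtype.ext hba : b = a) ▸ hb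

omit [LieAlgebra K L] [LieModule K L M] in
/-- A complemented Lie submodule is the image of an equivariant retraction. -/
lemma LieSubmodule.exists_retraction_of_isCompl {A B : LieSubmodule K L M} (h : IsCompl A B) :
    ∃ r : M →ₗ⁅K,L⁆ A, ∀ a : A, r a = a := by
  have h' : IsCompl A.toSubmodule B.toSubmodule := LieSubmodule.isCompl_toSubmodule.mpr h
  let p := A.toSubmodule.projectionOnto B.toSubmodule h'
  have hA (a : M) (ha : a ∈ A) : p a = ⟨a, ha⟩ := Submodule.projectionOnto_apply_left h' ⟨a, ha⟩
  have hB (b : M) (hb : b ∈ B) : p b = 0 := Submodule.projectionOnto_apply_right h' ⟨b, hb⟩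
  refine ⟨{ toLinearMap := p, map_lie' := fun {x m} ↦ ?_ }, fun a ↦ hA a a.2⟩
  obtain ⟨a, ha, b, hb, rfl⟩ :=
    Submodule.mem_sup.mp (h'.sup_eq_top ▸ Submodule.mem_top (x := m))
  change p ⁅x, a + b⁆ = ⁅x, (show A from p (a + b))⁆
  rw [lie_add, map_add, map_add, hA _ ha, hA _ (A.lie_mem ha), hB _ hb, hB _ (B.lie_mem hb),
    add_zero, add_zero]
  rfl

end Homs

section Step

variable [CharZero K] [IsAlgClosed K] {X Y Z ι : Type*}
  [AddCommGroup X] [Module K X] [LieRingModule L X] [LieModule K L X] [FiniteDimensional K X]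
  [AddCommGroup Y] [Module K Y] [LieRingModule L Y] [LieModule K L Y]
  [AddCommGroup Z] [Module K Z] [LieRingModule L Z] [LieModule K L Z] [FiniteDimensional K Z]

omit [LieModule K L Y] in
/-- A nonzero map `X ⊗ Y → Z` with `X` irreducible gives an irreducible submodule of
`X →ₗ[K] Z` which is the target of a nonzero map from `Y`. -/
lemma exists_isIrreducible_submodule_linearMap [IsIrreducible K L X] [IsIrreducible K L Z]
    {g : Y →ₗ⁅K,L⁆ X →ₗ[K] Z} (hg : g ≠ 0) :
    ∃ A : LieSubmodule K L (X →ₗ[K] Z), IsIrreducible K L A ∧ ∃ q : Y →ₗ⁅K,L⁆ A, q ≠ 0 := by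
  have hrange : g.range ≠ ⊥ := fun h ↦ hg <| by
    ext1 y
    exact (LieSubmodule.mem_bot _).mp (h ▸ (g.mem_range (g y)).mpr ⟨y, rfl⟩)
  obtain ⟨A, hA, hAg⟩ := (eq_bot_or_exists_atom_le g.range).resolve_left hrange
  obtain ⟨r, hr⟩ := exists_retraction_linearMap A
  refine ⟨A, LieSubmodule.isIrreducible_of_isAtom hA, r.comp g, fun h ↦ hA.1 ?_⟩
  refine (LieSubmodule.eq_bot_iff _).mpr fun a ha ↦ ?_
  obtain ⟨y, rfl⟩ := (g.mem_range a).mp (hAg ha)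
  rw [← Subtype.coe_mk (g y) ha, ← hr ⟨g y, ha⟩]
  exact congrArg Subtype.val (LieModuleHom.congr_fun h y)

/-- Factoring one tensor factor off a nonzero map `X ⊗ Y → Z` through an irreducible module. -/
lemma exists_isIrreducible_of_tensor_hom [DecidableEq ι] {N : ι → LieSubmodule K L X}
    (hN : DirectSum.IsInternal fun i ↦ (N i).toSubmodule) (hirr : ∀ i, IsIrreducible K L (N i))
    [IsIrreducible K L Z] {f : X ⊗[K] Y →ₗ⁅K,L⁆ Z} (hf : f ≠ 0) :
    ∃ (i : ι) (A : LieSubmodule K L (N i →ₗ[K] Z)), IsIrreducible K L A ∧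
      (∃ q : Y →ₗ⁅K,L⁆ A, q ≠ 0) ∧ ∃ e : X ⊗[K] A →ₗ⁅K,L⁆ Z, e ≠ 0 := by
  let F : X →ₗ⁅K,L⁆ Y →ₗ[K] Z := (TensorProduct.LieModule.liftLie K L X Y Z).symm f
  have hF : F ≠ 0 := by simpa [F] using hf
  have hindep : iSupIndep N := (LieSubmodule.iSupIndep_toSubmodule).mp hN.submodule_iSupIndep
  have htop : ⨆ i, N i = ⊤ := by
    rw [← LieSubmodule.toSubmodule_eq_top, LieSubmodule.iSup_toSubmodule]
    exact hN.submodule_iSup_eq_top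
  obtain ⟨i, hi⟩ : ∃ i, F.comp (N i).incl ≠ 0 := by
    by_contra! h
    have hle : ⨆ i, N i ≤ F.ker := iSup_le fun i x hx ↦
      F.mem_ker.mpr (LieModuleHom.congr_fun (h i) ⟨x, hx⟩)
    refine hF (LieModuleHom.ext fun x ↦ F.mem_ker.mp (hle ?_))
    exact htop ▸ LieSubmodule.mem_top x
  obtain ⟨A, hA, hq⟩ := exists_isIrreducible_submodule_linearMap (g := (F.comp (N i).incl).flip)
    fun h ↦ hi <| by
      ext x y
      exact LinearMap.congr_fun (LieModuleHom.congr_fun h y) x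
  have hcompl : IsCompl (N i) (⨆ (j) (_ : j ≠ i), N j) :=
    ⟨hindep i, codisjoint_iff_le_sup.mpr <| htop ▸ iSup_le fun j ↦ by
      by_cases hj : j = i
      · exact hj ▸ le_sup_left
      · exact le_sup_of_le_right (le_iSup₂_of_le j hj le_rfl)⟩
  obtain ⟨p, hp⟩ := LieSubmodule.exists_retraction_of_isCompl hcompl
  refine ⟨i, A, hA, hq, TensorProduct.LieModule.liftLie K L X A Z (A.incl.flip.comp p), fun h ↦ ?_⟩
  have h0 : A.incl.flip.comp p = 0 := by simpa using h
  have := nontrivial_of_isIrreducible K L A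
  obtain ⟨a, ha⟩ := exists_ne (0 : A)
  refine ha (Subtype.ext (LinearMap.ext fun x ↦ ?_))
  simpa [hp] using LinearMap.congr_fun (LieModuleHom.congr_fun h0 (x : X)) a

end Step

end Chain

/-- A nonzero map `U^{⊗m} ⊗ V → B` to an irreducible module yields a chain ending in `B`. -/
theorem exists_chain_of_tensorPowTensor_hom {k l U V : Type u} [Field k] [IsAlgClosed k]
    [CharZero k] [LieRing l] [LieAlgebra k l]
    [AddCommGroup U] [Module k U] [LieRingModule l U] [LieModule k l U] [FiniteDimensional k U]
    [AddCommGroup V] [Module k V] [LieRingModule l V] [LieModule k l V] [IsIrreducible k l V]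
    {ι : Type*} [DecidableEq ι] {N : ι → LieSubmodule k l U}
    (hN : DirectSum.IsInternal fun i ↦ (N i).toSubmodule) (hirr : ∀ i, IsIrreducible k l (N i))
    (m : ℕ) (B : LieModuleBundle k l) [IsIrreducible k l B.carrier]
    [FiniteDimensional k B.carrier] {f : (tensorPowTensor k l U V m).carrier →ₗ⁅k,l⁆ B.carrier}
    (hf : f ≠ 0) :
    ∃ Vs : Fin (m + 1) → LieModuleBundle k l,
      (∀ i, IsIrreducible k l (Vs i).carrier ∧ FiniteDimensional k (Vs i).carrier) ∧
      Nonempty ((Vs 0).carrier ≃ₗ⁅k,l⁆ V) ∧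
      Vs (Fin.last m) = B ∧
      ∀ i : Fin m,
        ∃ f : (U ⊗[k] (Vs i.castSucc).carrier) →ₗ⁅k,l⁆ (Vs i.succ).carrier, f ≠ 0 := by
  induction m generalizing B with
  | zero =>
    obtain ⟨e⟩ : Nonempty (V ≃ₗ⁅k,l⁆ B.carrier) :=
      LieModuleHom.nonempty_equiv_of_ne_zero (f := f) hf
    exact ⟨fun _ ↦ B, fun _ ↦ ⟨inferInstance, inferInstance⟩, ⟨e.symm⟩, rfl, fun i ↦ i.elim0⟩
  | succ m ih =>
    obtain ⟨i, A, hA, ⟨q, hq⟩, e, he⟩ :=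
      exists_isIrreducible_of_tensor_hom (X := U) (Y := (tensorPowTensor k l U V m).carrier)
        hN hirr (f := f) hf
    obtain ⟨Vs, hirrVs, hV, hlast, hlink⟩ := ih ⟨A⟩ hq
    have hsnoc (i : Fin (m + 1)) :
        Fin.snoc (α := fun _ ↦ LieModuleBundle k l) Vs B i.castSucc = Vs i :=
      Fin.snoc_castSucc ..
    have hsnoc_last : Fin.snoc (α := fun _ ↦ LieModuleBundle k l) Vs B (Fin.last (m + 1)) = B :=
      Fin.snoc_last ..
    refine ⟨Fin.snoc (α := fun _ ↦ LieModuleBundle k l) Vs B, fun i ↦ ?_, ?_, hsnoc_last,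
      fun i ↦ ?_⟩
    · cases i using Fin.lastCases with
      | last => rw [hsnoc_last]; exact ⟨inferInstance, inferInstance⟩
      | cast i => rw [hsnoc]; exact hirrVs i
    · rw [← Fin.castSucc_zero, hsnoc]
      exact hV
    · cases i using Fin.lastCases with
      | last => rw [Fin.succ_last, hsnoc, hsnoc_last, hlast]; exact ⟨e, he⟩
      | cast i => rw [Fin.succ_castSucc, hsnoc, hsnoc]; exact hlink i

/-- Let `U` be a finite-dimensional completely reducible `l`-module and
`V, W` irreducible finite-dimensional `l`-modules with `Hom_l(U^{⊗m} ⊗ V, W) ≠ 0` for some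
`m ≥ 1`.  Then there is a chain `V₀ ≅ V, V₁, …, V_m ≅ W` of irreducible finite-dimensional
`l`-modules with `Hom_l(U ⊗ V_i, V_{i+1}) ≠ 0` for all `0 ≤ i < m`. -/
theorem chain_of_hom_tensorPow [FiniteDimensional k U] [FiniteDimensional k V]
    [FiniteDimensional k W]
    (hUcr : ∃ (ι : Type u) (_ : DecidableEq ι) (N : ι → LieSubmodule k l U),
      DirectSum.IsInternal (fun i => (N i : Submodule k U)) ∧
        ∀ i, LieModule.IsIrreducible k l ↥(N i))
    [LieModule.IsIrreducible k l V] [LieModule.IsIrreducible k l W]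
    (m : ℕ) (hm : 1 ≤ m)
    (hHom : ∃ f : (tensorPowTensor k l U V m).carrier →ₗ⁅k,l⁆ W, f ≠ 0) :
    ∃ Vs : Fin (m + 1) → LieModuleBundle k l,
      (∀ i, LieModule.IsIrreducible k l (Vs i).carrier ∧ FiniteDimensional k (Vs i).carrier) ∧
      Nonempty ((Vs 0).carrier ≃ₗ⁅k,l⁆ V) ∧
      Nonempty ((Vs (Fin.last m)).carrier ≃ₗ⁅k,l⁆ W) ∧
      ∀ i : Fin m,
        ∃ f : (U ⊗[k] (Vs i.castSucc).carrier) →ₗ⁅k,l⁆ (Vs i.succ).carrier, f ≠ 0 := by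
  obtain ⟨ι, _, N, hN, hirr⟩ := hUcr
  obtain ⟨f, hf⟩ := hHom
  obtain ⟨Vs, hirrVs, hV, hlast, hlink⟩ :=
    exists_chain_of_tensorPowTensor_hom hN hirr m ⟨W⟩ (f := f) hf
  refine ⟨Vs, hirrVs, hV, ?_, hlink⟩
  rw [hlast]
  exact ⟨LieModuleEquiv.refl⟩
end

section
/- Let s be a finite-dimensional semisimple Lie algebra over an algebraically closed field k of characteristic 0 and let V be a faithful irreducible finite-dimensional s-module. Then the ℤ-span of the set of weights of V ⊗ V* equals the root lattice Q of s. -/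
open scoped TensorProduct

universe u

variable (k s : Type u) [Field k] [IsAlgClosed k] [CharZero k]
  [LieRing s] [LieAlgebra k s] [FiniteDimensional k s] [LieAlgebra.IsSemisimple k s]
variable (H : LieSubalgebra k s) [H.IsCartanSubalgebra]

/-- The weight space of a module `M` for a linear functional `χ` on the Cartan subalgebra
`H`: the set of `m` with `x • m = χ(x) m` for all `x ∈ H`. -/
def wtSpace (M : Type u) [AddCommGroup M] [Module k M] [LieRingModule s M]
    [LieModule k s M] (χ : Module.Dual k ↥H) : Submodule k M where
  carrier := {m | ∀ x : ↥H, ⁅(x : s), m⁆ = χ x • m}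
  add_mem' := by intro a b ha hb x; rw [lie_add, ha x, hb x, smul_add]
  zero_mem' := by intro x; simp
  smul_mem' := by intro c m hm x; rw [lie_smul, hm x, smul_comm]

/-- `χ` is a weight of `M` if the corresponding weight space is nonzero. -/
def IsWeightOf (M : Type u) [AddCommGroup M] [Module k M] [LieRingModule s M]
    [LieModule k s M] (χ : Module.Dual k ↥H) : Prop :=
  wtSpace k s H M χ ≠ ⊥

/-- The roots of `s` relative to `H`: the nonzero weights of the adjoint module. -/
def IsRoot (χ : Module.Dual k ↥H) : Prop :=
  χ ≠ 0 ∧ IsWeightOf k s H s χ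

/-- The root lattice `Q`: the additive subgroup of `(H)^*` generated by the roots. -/
def rootLattice : AddSubgroup (Module.Dual k ↥H) :=
  AddSubgroup.closure {χ | IsRoot k s H χ}

/-- A positive system of roots: a set of roots such that exactly one of `±α` is positive for
every root `α`, and which is closed under addition of roots. -/
def IsPositiveSystem (Pos : Set (Module.Dual k ↥H)) : Prop :=
  (∀ χ ∈ Pos, IsRoot k s H χ) ∧
  (∀ χ, IsRoot k s H χ → (χ ∈ Pos ↔ ¬ (-χ ∈ Pos))) ∧
  (∀ α ∈ Pos, ∀ β ∈ Pos, IsRoot k s H (α + β) → α + β ∈ Pos)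

/-- `lam` is the highest weight of the module `M` relative to the positive system `Pos`:
it is a weight, and every weight of `M` is obtained from it by subtracting positive roots. -/
def IsHighestWeightOf (Pos : Set (Module.Dual k ↥H))
    (M : Type u) [AddCommGroup M] [Module k M] [LieRingModule s M] [LieModule k s M]
    (lam : Module.Dual k ↥H) : Prop :=
  IsWeightOf k s H M lam ∧
    ∀ χ, IsWeightOf k s H M χ → lam - χ ∈ AddSubmonoid.closure Pos

/-- `σ` is the reflection in the Weyl group attached to a root `α`: an involution sending
`α` to `-α`, moving every functional along `α` only, and preserving the set of roots. -/
def IsWeylReflection (σ : Module.Dual k ↥H ≃ₗ[k] Module.Dual k ↥H) : Prop :=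
  ∃ α, IsRoot k s H α ∧ σ α = -α ∧ σ * σ = 1 ∧
    (∀ χ, ∃ c : k, χ - σ χ = c • α) ∧ (∀ β, IsRoot k s H β → IsRoot k s H (σ β))

/-- The Weyl group `W(s)`, as the group of automorphisms of `(H)^*` generated by the
reflections in the roots. -/
def weylGroup : Subgroup (Module.Dual k ↥H ≃ₗ[k] Module.Dual k ↥H) :=
  Subgroup.closure {σ | IsWeylReflection k s H σ}

section WeightSpaces

variable {k s H}
variable {M : Type u} [AddCommGroup M] [Module k M] [LieRingModule s M] [LieModule k s M]

omit [IsAlgClosed k] [CharZero k] [FiniteDimensional k s] [LieAlgebra.IsSemisimple k s]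
  [H.IsCartanSubalgebra] in
lemma lie_mem_wtSpace {α χ : Module.Dual k ↥H} {y : s} {m : M}
    (hy : y ∈ wtSpace k s H s α) (hm : m ∈ wtSpace k s H M χ) :
    ⁅y, m⁆ ∈ wtSpace k s H M (α + χ) := by
  intro x
  rw [leibniz_lie, hy x, hm x, smul_lie, lie_smul, LinearMap.add_apply, add_smul]

omit [IsAlgClosed k] [CharZero k] [FiniteDimensional k s] [LieAlgebra.IsSemisimple k s] in
lemma wtSpace_le_genWeightSpace (χ : Module.Dual k ↥H) :
    wtSpace k s H M χ ≤ (LieModule.genWeightSpace M (χ : ↥H → k)).toSubmodule := by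
  intro m hm
  refine LieModule.weightSpace_le_genWeightSpace M (χ : ↥H → k) ?_
  rw [LieModule.mem_weightSpace]
  exact hm

omit [IsAlgClosed k] [CharZero k] [FiniteDimensional k s] [LieAlgebra.IsSemisimple k s] in
lemma iSupIndep_wtSpace : iSupIndep (wtSpace k s H M) := by
  have h := LieSubmodule.iSupIndep_toSubmodule.mpr (LieModule.iSupIndep_genWeightSpace k ↥H M)
  exact (h.comp DFunLike.coe_injective).mono wtSpace_le_genWeightSpace

omit [IsAlgClosed k] [CharZero k] [FiniteDimensional k s] [LieAlgebra.IsSemisimple k s] in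
/-- If a family of weight spaces spans the module, then every weight belongs to the family. -/
lemma IsWeightOf.mem_range_of_iSup_eq_top {ι : Sort*} {f : ι → Module.Dual k ↥H}
    (hf : ⨆ i, wtSpace k s H M (f i) = ⊤) {χ : Module.Dual k ↥H} (hχ : IsWeightOf k s H M χ) :
    χ ∈ Set.range f := by
  by_contra h
  refine hχ ((iSupIndep_wtSpace χ).eq_bot_of_le ?_)
  refine le_top.trans (hf.symm.le.trans (iSup_le fun i ↦ ?_))
  exact le_iSup₂_of_le (f i) (fun hi ↦ h ⟨i, hi⟩) le_rfl

omit [FiniteDimensional k s] [LieAlgebra.IsSemisimple k s] in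
lemma exists_isWeightOf [FiniteDimensional k M] [Nontrivial M] :
    ∃ χ, IsWeightOf k s H M χ := by
  obtain ⟨χ, hχ⟩ := LieModule.exists_nontrivial_weightSpace_of_isNilpotent k ↥H M
  obtain ⟨⟨m, hm⟩, hm0⟩ := exists_ne (0 : LieModule.weightSpace M χ)
  refine ⟨χ, (Submodule.ne_bot_iff _).mpr ⟨m, ?_, fun h ↦ hm0 (Subtype.ext h)⟩⟩
  rwa [LieModule.mem_weightSpace] at hm

variable (k s H)

lemma iSup_wtSpace_rootLattice_eq_top :
    ⨆ α : rootLattice k s H, wtSpace k s H s α = ⊤ := by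
  have h := congrArg LieSubmodule.toSubmodule (LieModule.iSup_genWeightSpace_eq_top' k ↥H s)
  rw [LieSubmodule.iSup_toSubmodule, LieSubmodule.top_toSubmodule] at h
  refine top_le_iff.mp (h.symm.le.trans (iSup_le fun χ ↦ ?_))
  have hle : (LieModule.genWeightSpace s (χ : ↥H → k)).toSubmodule ≤
      wtSpace k s H s χ.toLinear :=
    fun y hy x ↦ LieAlgebra.IsKilling.lie_eq_smul_of_mem_rootSpace hy x
  have hmem : χ.toLinear ∈ rootLattice k s H := by
    by_cases h0 : χ.toLinear = 0
    · exact h0 ▸ zero_mem _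
    · refine AddSubgroup.subset_closure ⟨h0, fun hbot ↦
        LieModule.Weight.genWeightSpace_ne_bot s χ ?_⟩
      rw [← LieSubmodule.toSubmodule_eq_bot]
      exact le_bot_iff.mp (hle.trans hbot.le)
  exact hle.trans (le_iSup (fun α : rootLattice k s H ↦ wtSpace k s H s α) ⟨_, hmem⟩)

variable {k s H}

/-- An irreducible module is the sum of its weight spaces for the weights in a single coset of
the root lattice. -/
lemma IsWeightOf.iSup_wtSpace_add_eq_top [LieModule.IsIrreducible k s M]
    {χ : Module.Dual k ↥H} (hχ : IsWeightOf k s H M χ) :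
    ⨆ α : rootLattice k s H, wtSpace k s H M (α + χ) = ⊤ := by
  let N : LieSubmodule k s M :=
    { (⨆ α : rootLattice k s H, wtSpace k s H M (α + χ)) with
      lie_mem := by
        intro y m hm
        have hy : y ∈ ⨆ α : rootLattice k s H, wtSpace k s H s α := by
          rw [iSup_wtSpace_rootLattice_eq_top]; trivial
        change m ∈ ⨆ α : rootLattice k s H, wtSpace k s H M (α + χ) at hm
        change ⁅y, m⁆ ∈ ⨆ α : rootLattice k s H, wtSpace k s H M (α + χ)
        induction hy using Submodule.iSup_induction' with
        | zero => simp
        | add y z _ _ hy hz => rw [add_lie]; exact add_mem hy hz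
        | mem α y hy =>
          induction hm using Submodule.iSup_induction' with
          | zero => simp
          | add m n _ _ hm hn => rw [lie_add]; exact add_mem hm hn
          | mem β m hm =>
            refine Submodule.mem_iSup_of_mem (α + β) ?_
            rw [AddSubgroup.coe_add, add_assoc]
            exact lie_mem_wtSpace hy hm }
  have hN : N ≠ ⊥ := by
    obtain ⟨m, hm, hm0⟩ := (Submodule.ne_bot_iff _).mp hχ
    refine fun hbot ↦ hm0 ((LieSubmodule.mem_bot m).mp (hbot.le ?_))
    exact Submodule.mem_iSup_of_mem (p := fun α : rootLattice k s H ↦ wtSpace k s H M (α + χ)) 0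
      (by simpa using hm)
  exact congrArg LieSubmodule.toSubmodule ((IsSimpleOrder.eq_bot_or_eq_top N).resolve_left hN)

lemma IsWeightOf.sub_mem_rootLattice [LieModule.IsIrreducible k s M] {χ ψ : Module.Dual k ↥H}
    (hχ : IsWeightOf k s H M χ) (hψ : IsWeightOf k s H M ψ) :
    χ - ψ ∈ rootLattice k s H := by
  obtain ⟨α, hα⟩ := hχ.mem_range_of_iSup_eq_top hψ.iSup_wtSpace_add_eq_top
  rw [← hα, add_sub_cancel_right]
  exact α.2

omit [IsAlgClosed k] [CharZero k] [FiniteDimensional k s] [LieAlgebra.IsSemisimple k s]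
  [H.IsCartanSubalgebra] in
lemma IsWeightOf.of_lieModuleEquiv {M' : Type u} [AddCommGroup M'] [Module k M']
    [LieRingModule s M'] [LieModule k s M'] (e : M ≃ₗ⁅k, s⁆ M') {χ : Module.Dual k ↥H}
    (hχ : IsWeightOf k s H M χ) : IsWeightOf k s H M' χ := by
  obtain ⟨m, hm, hm0⟩ := (Submodule.ne_bot_iff _).mp hχ
  refine (Submodule.ne_bot_iff _).mpr
    ⟨e m, fun x ↦ ?_, fun h ↦ hm0 (e.injective (h.trans (map_zero e.toLinearEquiv).symm))⟩
  exact (e.toLieModuleHom.map_lie (x : s) m).symm.trans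
    ((congrArg e (hm x)).trans (map_smul e.toLinearEquiv (χ x) m))

/-- A weight of the endomorphisms of an irreducible module is a difference of two weights. -/
lemma IsWeightOf.mem_rootLattice_of_moduleEnd [FiniteDimensional k M] [LieModule.IsIrreducible k s M]
    {χ : Module.Dual k ↥H} (hχ : IsWeightOf k s H (M →ₗ[k] M) χ) : χ ∈ rootLattice k s H := by
  obtain ⟨f, hf, hf0⟩ := (Submodule.ne_bot_iff _).mp hχ
  have := LieModule.nontrivial_of_isIrreducible k s M
  obtain ⟨μ, hμ⟩ := exists_isWeightOf (k := k) (s := s) (H := H) (M := M)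
  obtain ⟨ψ, m, hm, hfm⟩ : ∃ ψ, ∃ m ∈ wtSpace k s H M ψ, f m ≠ 0 := by
    by_contra! h
    refine hf0 (LinearMap.ker_eq_top.mp (top_le_iff.mp ?_))
    exact hμ.iSup_wtSpace_add_eq_top.symm.le.trans (iSup_le fun α m hm ↦ h _ m hm)
  have hfm' : f m ∈ wtSpace k s H M (χ + ψ) := fun x ↦ by
    have h := LinearMap.congr_fun (hf x) m
    rw [LieHom.lie_apply, LinearMap.smul_apply, hm x, map_smul, sub_eq_iff_eq_add] at h
    rw [h, LinearMap.add_apply, add_smul]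
  have hψ : IsWeightOf k s H M ψ :=
    (Submodule.ne_bot_iff _).mpr ⟨m, hm, fun h ↦ hfm (by rw [h, map_zero])⟩
  have hχψ : IsWeightOf k s H M (χ + ψ) := (Submodule.ne_bot_iff _).mpr ⟨f m, hfm', hfm⟩
  simpa using hχψ.sub_mem_rootLattice hψ

omit [IsAlgClosed k] [CharZero k] [FiniteDimensional k s] [LieAlgebra.IsSemisimple k s]
  [H.IsCartanSubalgebra] in
/-- The weights of the adjoint module are weights of the endomorphisms of a faithful module. -/
lemma IsWeightOf.moduleEnd_of_faithful (hM : ∀ y : s, (∀ m : M, ⁅y, m⁆ = 0) → y = 0)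
    {χ : Module.Dual k ↥H} (hχ : IsWeightOf k s H s χ) : IsWeightOf k s H (M →ₗ[k] M) χ := by
  obtain ⟨y, hy, hy0⟩ := (Submodule.ne_bot_iff _).mp hχ
  refine (Submodule.ne_bot_iff _).mpr
    ⟨LieModule.toEnd k s M y, fun x ↦ ?_, fun h ↦ hy0 (hM y fun m ↦ ?_)⟩
  · ext m
    rw [LieHom.lie_apply, LinearMap.smul_apply, LieModule.toEnd_apply_apply,
      LieModule.toEnd_apply_apply, ← lie_lie, hy x, smul_lie]
  · exact LinearMap.congr_fun h m

variable (k s) in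
/-- The isomorphism of `M ⊗ M*` with the module of endomorphisms of `M`. -/
noncomputable def tensorDualEquivEnd [FiniteDimensional k M] :
    M ⊗[k] Module.Dual k M ≃ₗ⁅k, s⁆ (M →ₗ[k] M) :=
  { (TensorProduct.comm k M (Module.Dual k M)).trans (dualTensorHomEquiv k M M) with
    map_lie' := by
      intro y t
      change ((TensorProduct.comm k M (Module.Dual k M)).trans (dualTensorHomEquiv k M M)) ⁅y, t⁆ =
        ⁅y, ((TensorProduct.comm k M (Module.Dual k M)).trans (dualTensorHomEquiv k M M)) t⁆
      induction t using TensorProduct.induction_on with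
      | zero => simp
      | add a b ha hb => rw [lie_add, map_add, ha, hb, map_add, lie_add]
      | tmul m f =>
        ext v
        simp [dualTensorHomEquiv, TensorProduct.LieModule.lie_tmul_right, sub_eq_add_neg] }

end WeightSpaces

/-- Let `V` be a faithful irreducible finite-dimensional `s`-module.
Then the `ℤ`-span of the set of weights of `V ⊗ V*` equals the root lattice `Q`. -/
theorem span_weights_tensor_dual_eq_rootLattice
    (V : Type u) [AddCommGroup V] [Module k V] [LieRingModule s V] [LieModule k s V]
    [FiniteDimensional k V] [LieModule.IsIrreducible k s V]
    (hVfaithful : ∀ x : s, (∀ v : V, ⁅x, v⁆ = 0) → x = 0) :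
    AddSubgroup.closure {χ | IsWeightOf k s H (V ⊗[k] Module.Dual k V) χ} =
      rootLattice k s H := by
  apply le_antisymm
  · rw [AddSubgroup.closure_le]
    exact fun χ hχ ↦ (hχ.of_lieModuleEquiv (tensorDualEquivEnd k s)).mem_rootLattice_of_moduleEnd
  · rw [rootLattice, AddSubgroup.closure_le]
    exact fun α hα ↦ AddSubgroup.subset_closure
      ((hα.2.moduleEnd_of_faithful hVfaithful).of_lieModuleEquiv (tensorDualEquivEnd k s).symm)
end

section
/- Let k be a field, Δ an abelian group acting on a set S, and k[Δ] = ⊕_{δ∈Δ} k·e_δ the group algebra of Δ (with e_δ·e_μ = e_{δ+μ}). Let l = ⊕_{δ∈Δ} l_δ be a Δ-graded Lie algebra over k, let U = ⊕_{s∈S} U_s be an l-module with l_δ•U_s ⊆ U_{δ·s} for all δ ∈ Δ, s ∈ S, and let V = ⊕_{s∈S} V_s be a k[Δ]-module with e_δ·V_s ⊆ V_{δ·s}. Then: (a) the formula x_δ • (u_s ⊗ v_s) = (x_δ • u_s) ⊗ (e_δ · v_s), for x_δ ∈ l_δ, u_s ∈ U_s, v_s ∈ V_s, defines an l-module structure on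 W = ⊕_{s∈S} U_s ⊗ V_s; (b) for every Δ-orbit O ⊆ S, the subspace W_O = ⊕_{s∈O} U_s ⊗ V_s is an l-submodule of W; and (c) if Δ acts freely on the orbit O = Δ·s₀, then W_O is isomorphic as an l-module to (⊕_{s∈O} U_s) ⊗ V_{s₀}, where l acts only on the first tensor factor. -/
/-! Graded tensor product modules over a graded Lie algebra. -/

open scoped TensorProduct DirectSum

/-- Over a field, every subspace has a linear retraction. -/
theorem Submodule.exists_linearMap_retraction {K M : Type*} [Field K] [AddCommGroup M] [Module K M]
    (p : Submodule K M) : ∃ f : M →ₗ[K] p, ∀ m (hm : m ∈ p), f m = ⟨m, hm⟩ := by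
  obtain ⟨f, hf⟩ := LinearMap.exists_leftInverse_of_injective p.subtype p.ker_subtype
  exact ⟨f, fun m hm => LinearMap.congr_fun hf ⟨m, hm⟩⟩

/-- Linear maps out of `⨆ s ∈ O, p s` agree once they agree on every `p s`. -/
theorem Submodule.linearMap_ext_biSup {K M N ι : Type*} [Semiring K] [AddCommMonoid M] [Module K M]
    [AddCommMonoid N] [Module K N] {p : ι → Submodule K M} {O : Set ι}
    {f g : ↥(⨆ s ∈ O, p s) →ₗ[K] N}
    (h : ∀ s (hs : s ∈ O) m (hm : m ∈ p s),
      f ⟨m, le_iSup₂ (f := fun s (_ : s ∈ O) => p s) s hs hm⟩ =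
        g ⟨m, le_iSup₂ (f := fun s (_ : s ∈ O) => p s) s hs hm⟩) : f = g := by
  have key : (⨆ s ∈ O, p s) ≤ (LinearMap.eqLocus f g).map (⨆ s ∈ O, p s).subtype :=
    iSup₂_le fun s hs m hm => ⟨⟨m, _⟩, h s hs m hm, rfl⟩
  ext ⟨m, hm⟩
  obtain ⟨m', hm', rfl⟩ := key hm
  exact hm'

theorem Submodule.map_mem_of_mem_biSup {K M N ι : Type*} [Semiring K] [AddCommMonoid M]
    [Module K M] [AddCommMonoid N] [Module K N] {p : ι → Submodule K M} {O : Set ι}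
    (f : M →ₗ[K] N) {q : Submodule K N} (h : ∀ s ∈ O, ∀ m ∈ p s, f m ∈ q) {m : M}
    (hm : m ∈ ⨆ s ∈ O, p s) : f m ∈ q :=
  (iSup₂_le h : (⨆ s ∈ O, p s) ≤ q.comap f) hm

/-- Induction along an internal direct sum decomposition. -/
theorem DirectSum.IsInternal.induction_on {ι K M : Type*} [DecidableEq ι] [Semiring K]
    [AddCommMonoid M] [Module K M] {p : ι → Submodule K M} (h : DirectSum.IsInternal p)
    {motive : M → Prop} (mem : ∀ i, ∀ x ∈ p i, motive x) (zero : motive 0)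
    (add : ∀ x y, motive x → motive y → motive (x + y)) (x : M) : motive x :=
  Submodule.iSup_induction p (motive := motive) (h.submodule_iSup_eq_top ▸ Submodule.mem_top)
    mem zero add

/-- Linear maps on the summands of an internal direct sum decomposition glue to a linear map. -/
theorem DirectSum.IsInternal.exists_linearMap {ι K M N : Type*} [DecidableEq ι] [Semiring K]
    [AddCommMonoid M] [Module K M] [AddCommMonoid N] [Module K N] {p : ι → Submodule K M}
    (h : DirectSum.IsInternal p) (f : ∀ i, p i →ₗ[K] N) :
    ∃ F : M →ₗ[K] N, ∀ i x (hx : x ∈ p i), F x = f i ⟨x, hx⟩ := by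
  let e := LinearEquiv.ofBijective (DirectSum.coeLinearMap p) h
  refine ⟨DirectSum.toModule K ι N f ∘ₗ e.symm.toLinearMap, fun i x hx => ?_⟩
  have : e.symm x = DirectSum.lof K ι (fun i => p i) i ⟨x, hx⟩ := by
    rw [LinearEquiv.symm_apply_eq]
    exact (DirectSum.coeLinearMap_of p i ⟨x, hx⟩).symm
  simp [this]

/-- Pure tensors in equal degrees with equal underlying vectors give the same element of the direct
sum. -/
theorem DirectSum.of_tmul_congr {ι K M N : Type*} [DecidableEq ι] [CommSemiring K]
    [AddCommMonoid M] [Module K M] [AddCommMonoid N] [Module K N] {p : ι → Submodule K M}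
    {q : ι → Submodule K N} {i j : ι} (hij : i = j) {a : p i} {b : q i} {a' : p j} {b' : q j}
    (ha : (a : M) = a') (hb : (b : N) = b') :
    DirectSum.of (fun i => p i ⊗[K] q i) i (a ⊗ₜ b) =
      DirectSum.of (fun i => p i ⊗[K] q i) j (a' ⊗ₜ b') := by
  subst hij
  rw [Subtype.ext ha, Subtype.ext hb]

/-- Linear maps out of a direct sum of tensor products agree once they agree on pure tensors. -/
theorem DirectSum.linearMap_ext_of_tmul {ι K P : Type*} {M N : ι → Type*} [DecidableEq ι]
    [CommSemiring K] [∀ i, AddCommMonoid (M i)] [∀ i, Module K (M i)] [∀ i, AddCommMonoid (N i)]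
    [∀ i, Module K (N i)] [AddCommMonoid P] [Module K P] {f g : (⨁ i, M i ⊗[K] N i) →ₗ[K] P}
    (h : ∀ i a b, f (DirectSum.of (fun i => M i ⊗[K] N i) i (a ⊗ₜ b)) =
      g (DirectSum.of (fun i => M i ⊗[K] N i) i (a ⊗ₜ b))) : f = g := by
  refine DirectSum.linearMap_ext K fun i => TensorProduct.ext' fun a b => ?_
  simpa [DirectSum.lof_eq_of] using h i a b

variable (k Δ S l U V : Type*) [Field k] [CommGroup Δ] [DecidableEq Δ] [MulAction Δ S] [DecidableEq S]
  [LieRing l] [LieAlgebra k l]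
  [AddCommGroup U] [Module k U] [LieRingModule l U] [LieModule k l U]
  [AddCommGroup V] [Module k V] [DistribMulAction Δ V] [SMulCommClass Δ k V]

/-- Let `Δ` be an abelian group acting on a set `S`, let
`l = ⊕_{δ∈Δ} l_δ` be a `Δ`-graded Lie algebra, `U = ⊕_{s∈S} U_s` an `l`-module with
`l_δ • U_s ⊆ U_{δ·s}`, and `V = ⊕_{s∈S} V_s` a `k[Δ]`-module with `e_δ · V_s ⊆ V_{δ·s}`.
Then: (a) `x_δ • (u_s ⊗ v_s) = (x_δ • u_s) ⊗ (e_δ · v_s)` defines an `l`-module structure on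
`W = ⊕_{s ∈ S} U_s ⊗ V_s`; (b) for every `Δ`-orbit `O ⊆ S` the subspace
`W_O = ⊕_{s∈O} U_s ⊗ V_s` is an `l`-submodule; and (c) if `Δ` acts freely on the orbit
`O = Δ·s₀`, then `W_O ≅ (⊕_{s∈O} U_s) ⊗ V_{s₀}` as `l`-modules, where `l` acts only on the
first tensor factor. -/
theorem graded_tensor_module
    (ℓ : Δ → Submodule k l) (hl : DirectSum.IsInternal ℓ)
    (hbr : ∀ (δ μ : Δ) (x y : l), x ∈ ℓ δ → y ∈ ℓ μ → ⁅x, y⁆ ∈ ℓ (δ * μ))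
    (u : S → Submodule k U) (hu : DirectSum.IsInternal u)
    (hlu : ∀ (δ : Δ) (x : l), x ∈ ℓ δ → ∀ (s : S) (m : U), m ∈ u s → ⁅x, m⁆ ∈ u (δ • s))
    (v : S → Submodule k V) (hv : DirectSum.IsInternal v)
    (hdv : ∀ (δ : Δ) (s : S), ∀ m ∈ v s, δ • m ∈ v (δ • s)) :
    ∃ ρ : l →ₗ[k] Module.End k (⨁ s : S, (↥(u s) ⊗[k] ↥(v s))),
      -- (a) `ρ` is an action of the Lie algebra `l` ...
      (∀ (x y : l) (w : ⨁ s : S, (↥(u s) ⊗[k] ↥(v s))),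
        ρ ⁅x, y⁆ w = ρ x (ρ y w) - ρ y (ρ x w)) ∧
      -- ... given on homogeneous elements by the stated formula:
      (∀ (δ : Δ) (x : l) (hx : x ∈ ℓ δ) (s : S) (a : ↥(u s)) (b : ↥(v s)),
        ρ x (DirectSum.of (fun s : S => (↥(u s) ⊗[k] ↥(v s))) s (a ⊗ₜ[k] b)) =
          DirectSum.of (fun s : S => (↥(u s) ⊗[k] ↥(v s))) (δ • s)
            ((⟨⁅x, (a : U)⁆, hlu δ x hx s a a.2⟩ : ↥(u (δ • s))) ⊗ₜ[k]
              (⟨δ • (b : V), hdv δ s b b.2⟩ : ↥(v (δ • s))))) ∧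
      -- (b) each `W_O` is an `l`-submodule:
      ∃ hWinv : ∀ (s₀ : S) (x : l) (w : ⨁ s : S, (↥(u s) ⊗[k] ↥(v s))),
          w ∈ (⨆ s ∈ MulAction.orbit Δ s₀,
              LinearMap.range (DirectSum.lof k S (fun s : S => (↥(u s) ⊗[k] ↥(v s))) s)) →
          ρ x w ∈ (⨆ s ∈ MulAction.orbit Δ s₀,
              LinearMap.range (DirectSum.lof k S (fun s : S => (↥(u s) ⊗[k] ↥(v s))) s)),
      ∃ hUinv : ∀ (s₀ : S) (x : l) (m : U),
          m ∈ (⨆ s ∈ MulAction.orbit Δ s₀, u s) → ⁅x, m⁆ ∈ (⨆ s ∈ MulAction.orbit Δ s₀, u s),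
      -- (c) on a free orbit, `W_O ≅ (⊕_{s∈O} U_s) ⊗ V_{s₀}` with `l` acting on the first factor:
      ∀ s₀ : S, (∀ δ : Δ, δ • s₀ = s₀ → δ = 1) →
        ∃ e : ↥(⨆ s ∈ MulAction.orbit Δ s₀,
              LinearMap.range (DirectSum.lof k S (fun s : S => (↥(u s) ⊗[k] ↥(v s))) s)) ≃ₗ[k]
            (↥(⨆ s ∈ MulAction.orbit Δ s₀, u s) ⊗[k] ↥(v s₀)),
          ∀ (x : l) (w : ↥(⨆ s ∈ MulAction.orbit Δ s₀,
              LinearMap.range (DirectSum.lof k S (fun s : S => (↥(u s) ⊗[k] ↥(v s))) s))),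
            e ⟨ρ x (w : ⨁ s : S, (↥(u s) ⊗[k] ↥(v s))), hWinv s₀ x w w.2⟩ =
              LinearMap.rTensor ↥(v s₀)
                ((LieModule.toEnd k l U x).restrict (fun m hm => hUinv s₀ x m hm)) (e w) := by
  choose qU hqU using fun s => (u s).exists_linearMap_retraction
  choose qV hqV using fun s => (v s).exists_linearMap_retraction
  let τ (δ : Δ) : l →ₗ[k] Module.End k (⨁ s : S, (↥(u s) ⊗[k] ↥(v s))) :=
    { toFun := fun x => DirectSum.toModule k S _ fun s =>
        DirectSum.lof k S (fun s : S => (↥(u s) ⊗[k] ↥(v s))) (δ • s) ∘ₗ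
          TensorProduct.map (qU (δ • s) ∘ₗ LieModule.toEnd k l U x ∘ₗ (u s).subtype)
            (qV (δ • s) ∘ₗ DistribSMul.toLinearMap k V δ ∘ₗ (v s).subtype)
      map_add' := fun x y => DirectSum.linearMap_ext_of_tmul fun s a b => by
        simp [← DirectSum.lof_eq_of k, TensorProduct.add_tmul]
      map_smul' := fun c x => DirectSum.linearMap_ext_of_tmul fun s a b => by
        simp [← DirectSum.lof_eq_of k, ← TensorProduct.smul_tmul'] }
  obtain ⟨ρ, hρτ⟩ := hl.exists_linearMap fun δ => τ δ ∘ₗ (ℓ δ).subtype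
  have hρ : ∀ (δ : Δ) (x : l) (hx : x ∈ ℓ δ) (s : S) (a : ↥(u s)) (b : ↥(v s)),
      ρ x (DirectSum.of (fun s : S => (↥(u s) ⊗[k] ↥(v s))) s (a ⊗ₜ[k] b)) =
        DirectSum.of (fun s : S => (↥(u s) ⊗[k] ↥(v s))) (δ • s)
          ((⟨⁅x, (a : U)⁆, hlu δ x hx s a a.2⟩ : ↥(u (δ • s))) ⊗ₜ[k]
            (⟨δ • (b : V), hdv δ s b b.2⟩ : ↥(v (δ • s)))) := by
    intro δ x hx s a b
    rw [hρτ δ x hx, ← hqU _ _ (hlu δ x hx s a a.2), ← hqV _ _ (hdv δ s b b.2)]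
    simp [τ, ← DirectSum.lof_eq_of k]
  have hUinv : ∀ (s₀ : S) (x : l) (m : U),
      m ∈ (⨆ s ∈ MulAction.orbit Δ s₀, u s) → ⁅x, m⁆ ∈ (⨆ s ∈ MulAction.orbit Δ s₀, u s) := by
    intro s₀ x m hm
    induction x using hl.induction_on with
    | zero => simp
    | add x y hx hy => simpa using add_mem hx hy
    | mem δ x hx =>
      refine Submodule.map_mem_of_mem_biSup (LieModule.toEnd k l U x) ?_ hm
      intro s hs a ha
      exact le_iSup₂ (f := fun s (_ : s ∈ MulAction.orbit Δ s₀) => u s) (δ • s)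
          (MulAction.mem_orbit_of_mem_orbit δ hs) (hlu δ x hx s a ha)
  refine ⟨ρ, ?_, hρ, ?_, hUinv, ?_⟩
  · intro x y w
    suffices h : ρ ⁅x, y⁆ + ρ y ∘ₗ ρ x = ρ x ∘ₗ ρ y from
      eq_sub_of_add_eq (LinearMap.congr_fun h w)
    induction x using hl.induction_on with
    | zero => simp
    | add x x' hx hx' =>
      rw [add_lie, map_add, map_add, LinearMap.add_comp, LinearMap.comp_add, ← hx, ← hx',
        add_add_add_comm]
    | mem δ x hx =>
      induction y using hl.induction_on with
      | zero => simp
      | add y y' hy hy' =>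
        rw [lie_add, map_add, map_add, LinearMap.add_comp, LinearMap.comp_add, ← hy, ← hy',
          add_add_add_comm]
      | mem μ y hy =>
        refine DirectSum.linearMap_ext_of_tmul fun s a b => ?_
        have hxy : ⁅x, ⁅y, (a : U)⁆⁆ ∈ u ((δ * μ) • s) :=
          mul_smul δ μ s ▸ hlu δ x hx _ _ (hlu μ y hy s a a.2)
        have hyx : ⁅y, ⁅x, (a : U)⁆⁆ ∈ u ((δ * μ) • s) :=
          mul_comm δ μ ▸ mul_smul μ δ s ▸ hlu μ y hy _ _ (hlu δ x hx s a a.2)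
        have hb : (δ * μ) • (b : V) ∈ v ((δ * μ) • s) := hdv _ s b b.2
        simp only [LinearMap.add_apply, LinearMap.comp_apply]
        rw [hρ _ _ (hbr δ μ x y hx hy), hρ μ y hy, hρ δ x hx, hρ δ x hx, hρ μ y hy,
          DirectSum.of_tmul_congr (i := δ • μ • s) (a' := ⟨_, hxy⟩) (b' := ⟨_, hb⟩)
            (mul_smul δ μ s).symm rfl (mul_smul δ μ (b : V)).symm,
          DirectSum.of_tmul_congr (i := μ • δ • s) (a' := ⟨_, hyx⟩) (b' := ⟨_, hb⟩)
            (by rw [mul_comm, mul_smul]) rfl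
            ((mul_smul μ δ (b : V)).symm.trans (by rw [mul_comm])),
          ← map_add, ← TensorProduct.add_tmul]
        exact DirectSum.of_tmul_congr rfl (by simp) rfl
  · intro s₀ x w hw
    induction x using hl.induction_on with
    | zero => simp
    | add x y hx hy => simpa using add_mem hx hy
    | mem δ x hx =>
      refine Submodule.map_mem_of_mem_biSup (ρ x) ?_ hw
      rintro s hs _ ⟨t, rfl⟩
      induction t with
      | zero => simp
      | add t t' ht ht' => simpa using add_mem ht ht'
      | tmul a b =>
        rw [DirectSum.lof_eq_of, hρ δ x hx, ← DirectSum.lof_eq_of k]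
        exact le_iSup₂ (f := fun s (_ : s ∈ MulAction.orbit Δ s₀) =>
          LinearMap.range (DirectSum.lof k S (fun s : S => (↥(u s) ⊗[k] ↥(v s))) s)) (δ • s)
          (MulAction.mem_orbit_of_mem_orbit δ hs) ⟨_, rfl⟩
  · intro s₀ hfree
    have hW := fun s (hs : s ∈ MulAction.orbit Δ s₀) =>
      le_iSup₂ (f := fun s (_ : s ∈ MulAction.orbit Δ s₀) =>
        LinearMap.range (DirectSum.lof k S (fun s : S => (↥(u s) ⊗[k] ↥(v s))) s)) s hs
    have hU := fun s (hs : s ∈ MulAction.orbit Δ s₀) =>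
      le_iSup₂ (f := fun s (_ : s ∈ MulAction.orbit Δ s₀) => u s) s hs
    have hg : ∀ s, ∃ g : Δ, s ∈ MulAction.orbit Δ s₀ → g • s₀ = s := fun s => by
      by_cases hs : s ∈ MulAction.orbit Δ s₀
      · obtain ⟨g, hg⟩ := hs
        exact ⟨g, fun _ => hg⟩
      · exact ⟨1, fun h => absurd h hs⟩
    choose g hg using hg
    have hgv : ∀ s ∈ MulAction.orbit Δ s₀, ∀ b ∈ v s, (g s)⁻¹ • b ∈ v s₀ := fun s hs b hb => by
      have := hdv (g s)⁻¹ s b hb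
      rwa [inv_smul_eq_iff.2 (hg s hs).symm] at this
    have hgv' : ∀ s ∈ MulAction.orbit Δ s₀, ∀ b ∈ v s₀, g s • b ∈ v s := fun s hs b hb => by
      have := hdv (g s) s₀ b hb
      rwa [hg s hs] at this
    have hgmul : ∀ δ, ∀ s ∈ MulAction.orbit Δ s₀, g (δ • s) = δ * g s := fun δ s hs => by
      refine (inv_mul_eq_one.1 (hfree _ ?_)).symm
      rw [mul_smul, hg _ (MulAction.mem_orbit_of_mem_orbit δ hs), inv_smul_eq_iff, mul_smul,
        hg s hs]
    obtain ⟨π, hπ⟩ := (⨆ s ∈ MulAction.orbit Δ s₀, u s).exists_linearMap_retraction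
    let F : (⨁ s : S, (↥(u s) ⊗[k] ↥(v s))) →ₗ[k]
        ↥(⨆ s ∈ MulAction.orbit Δ s₀, u s) ⊗[k] ↥(v s₀) :=
      DirectSum.toModule k S _ fun s => TensorProduct.map (π ∘ₗ (u s).subtype)
        (qV s₀ ∘ₗ DistribSMul.toLinearMap k V (g s)⁻¹ ∘ₗ (v s).subtype)
    have hF : ∀ s (hs : s ∈ MulAction.orbit Δ s₀) (a : u s) (b : v s),
        F (DirectSum.of (fun s : S => (↥(u s) ⊗[k] ↥(v s))) s (a ⊗ₜ b)) =
          ⟨a, hU s hs a.2⟩ ⊗ₜ ⟨(g s)⁻¹ • (b : V), hgv s hs b b.2⟩ := fun s hs a b => by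
      rw [← hπ, ← hqV]
      simp [F, ← DirectSum.lof_eq_of k]
    obtain ⟨G, hG⟩ := hu.exists_linearMap fun s =>
      ((TensorProduct.mk k (u s) (v s)).compl₂
        (qV s ∘ₗ DistribSMul.toLinearMap k V (g s) ∘ₗ (v s₀).subtype)).compr₂
          (DirectSum.lof k S (fun s : S => (↥(u s) ⊗[k] ↥(v s))) s)
    have hG' : ∀ s (hs : s ∈ MulAction.orbit Δ s₀) (a : U) (ha : a ∈ u s) (b : v s₀),
        G a b = DirectSum.of (fun s : S => (↥(u s) ⊗[k] ↥(v s))) s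
          (⟨a, ha⟩ ⊗ₜ ⟨g s • (b : V), hgv' s hs b b.2⟩) := fun s hs a ha b => by
      rw [hG s a ha, ← hqV s]
      simp [← DirectSum.lof_eq_of k]
    let G' : ↥(⨆ s ∈ MulAction.orbit Δ s₀, u s) ⊗[k] ↥(v s₀) →ₗ[k]
        (⨁ s : S, (↥(u s) ⊗[k] ↥(v s))) :=
      TensorProduct.lift (G ∘ₗ (⨆ s ∈ MulAction.orbit Δ s₀, u s).subtype)
    have hG'mem : ∀ t, G' t ∈ ⨆ s ∈ MulAction.orbit Δ s₀,
        LinearMap.range (DirectSum.lof k S (fun s : S => (↥(u s) ⊗[k] ↥(v s))) s) := fun t => by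
      induction t with
      | zero => simp
      | add t t' ht ht' => simpa using add_mem ht ht'
      | tmul a b =>
        obtain ⟨a, ha⟩ := a
        refine Submodule.map_mem_of_mem_biSup (G.flip b) ?_ ha
        intro s hs a ha
        rw [LinearMap.flip_apply, hG' s hs a ha, ← DirectSum.lof_eq_of k]
        exact hW s hs ⟨_, rfl⟩
    refine ⟨LinearEquiv.ofLinearMap (F ∘ₗ Submodule.subtype _) (G'.codRestrict _ hG'mem) ?_ ?_, ?_⟩
    · refine TensorProduct.ext (Submodule.linearMap_ext_biSup fun s hs a ha => ?_)
      ext b : 1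
      simp [G', hG' s hs a ha, hF s hs]
    · refine Submodule.linearMap_ext_biSup ?_
      rintro s hs _ ⟨t, rfl⟩
      refine Subtype.ext ?_
      change G' (F (DirectSum.lof k S _ s t)) = DirectSum.lof k S _ s t
      induction t with
      | zero => simp
      | add t t' ht ht' => simp only [map_add, ht, ht']
      | tmul a b =>
        rw [DirectSum.lof_eq_of, hF s hs]
        simp [G', hG' s hs]
    · intro x w
      suffices h : F ∘ₗ ρ x ∘ₗ Submodule.subtype _ = LinearMap.rTensor ↥(v s₀)
          ((LieModule.toEnd k l U x).restrict (fun m hm => hUinv s₀ x m hm)) ∘ₗ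
            F ∘ₗ Submodule.subtype _ from LinearMap.congr_fun h w
      refine Submodule.linearMap_ext_biSup ?_
      rintro s hs _ ⟨t, rfl⟩
      simp only [LinearMap.comp_apply, Submodule.subtype_apply]
      induction t with
      | zero => simp
      | add t t' ht ht' => simp only [map_add, ht, ht']
      | tmul a b =>
        rw [DirectSum.lof_eq_of, hF s hs, LinearMap.rTensor_tmul]
        refine Eq.trans ?_ (congrArg (· ⊗ₜ[k] _) (hπ _ (hUinv s₀ x a (hU s hs a.2))))
        induction x using hl.induction_on with
        | zero => simp
        | add x y hx hy => simp only [map_add, LinearMap.add_apply, add_lie, hx, hy,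
            TensorProduct.add_tmul]
        | mem δ x hx =>
          rw [hρ δ x hx, hF _ (MulAction.mem_orbit_of_mem_orbit δ hs),
            hπ _ (hUinv s₀ x a (hU s hs a.2))]
          congr 1
          refine Subtype.ext ?_
          simp only [hgmul δ s hs, mul_inv_rev, mul_smul, inv_smul_smul]
end
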